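/- arXiv:0707.3401 — 3 statements merged into one kernel-verified Lean document; each statement's English description precedes it below -/
import Mathlib

section
/- Let {μ_{nk}} be an infinitesimal array of probability measures on 𝕋, each with nonzero first moment, and let {λ_n}_{n≥1} ⊂ 𝕋. Suppose there exist γ ∈ 𝕋 and t > 0 such that λ_n · Π_{k=1}^{k_n} B_{μ_{nk}}(z) converges to γ·exp(−(t/2)(1+z)/(1−z)) uniformly on compact subsets of 𝔻 (i.e., the boolean convolutions converge weakly to the ⨃-normal distribution with parameters γ and σ = (t/2)δ₁). Then for every p ∈ ℤ, lim_{n→∞} λ_n^p · Π_{k=1}^{k_n} ∫_𝕋 ζ^p dμ_{nk}(ζ) = γ^p·exp(−t p²/2); i.e., the classical convolutions δ_{λ_n} ⊛ μ_{n1} ⊛ ⋯ ⊛ μ_{nk_n} converge weakly to the normal distribution on 𝕋 with Fourier coefficients γ^p e^{−tp²/2}. -/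
open MeasureTheory Complex Filter Topology Metric

noncomputable section

instance : MeasurableSpace Circle := borel Circle
instance : BorelSpace Circle := ⟨rfl⟩

/-- ψ_μ(z) = ∫ ζz/(1-ζz) dμ(ζ). -/
def psiT (μ : Measure Circle) (z : ℂ) : ℂ :=
  ∫ ζ : Circle, ((ζ : ℂ) * z) / (1 - (ζ : ℂ) * z) ∂μ

/-- The B-transform of a measure on the circle:
B_μ(z) = (1/z)·ψ_μ(z)/(1+ψ_μ(z)) for z ≠ 0 and B_μ(0) = ∫ ζ dμ. -/
def BT (μ : Measure Circle) (z : ℂ) : ℂ :=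
  if z = 0 then ∫ ζ : Circle, (ζ : ℂ) ∂μ
  else z⁻¹ * (psiT μ z / (1 + psiT μ z))

/-- Infinitesimal triangular array: max_{1≤k≤k_n} μ_{nk}{|ζ-1| ≥ ε} → 0 as n → ∞. -/
def IsInfinitesimalArrayT (kn : ℕ → ℕ) (μ : ℕ → ℕ → Measure Circle) : Prop :=
  ∀ ε : ℝ, 0 < ε → ∀ δ : ENNReal, 0 < δ → ∃ N : ℕ, ∀ n ≥ N, ∀ i < kn n,
    μ n i {ζ : Circle | ε ≤ ‖(ζ : ℂ) - 1‖} < δ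

/-- β = ∫_{|arg ζ|<τ} arg ζ dμ. -/
def betaT (τ : ℝ) (μ : Measure Circle) : ℝ :=
  ∫ ζ in {ζ : Circle | |Complex.arg (ζ : ℂ)| < τ}, Complex.arg (ζ : ℂ) ∂μ

/-- b = e^{iβ} as an element of the circle. -/
def bT (τ : ℝ) (μ : Measure Circle) : Circle := Circle.exp (betaT τ μ)

/-- μ° : the centering of μ, i.e. the pushforward of μ under ζ ↦ b⁻¹ ζ. -/
def centerT (τ : ℝ) (μ : Measure Circle) : Measure Circle :=
  Measure.map (fun ζ => (bT τ μ)⁻¹ * ζ) μ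

/-- h(z) = -i ∫ Im ζ dμ° + ∫ (1+ζz)/(1-ζz)·(1-Re ζ) dμ°, for the centered measure μ°. -/
def hT (τ : ℝ) (μ : Measure Circle) (z : ℂ) : ℂ :=
  -Complex.I * ((∫ ζ : Circle, ((ζ : ℂ)).im ∂(centerT τ μ) : ℝ) : ℂ) +
    ∫ ζ : Circle, ((1 + (ζ : ℂ) * z) / (1 - (ζ : ℂ) * z)) * ((1 - ((ζ : ℂ)).re : ℝ) : ℂ)
      ∂(centerT τ μ)

theorem Circle.integrable_of_continuous {E : Type*} [NormedAddCommGroup E]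
    (μ : Measure Circle) [IsFiniteMeasure μ] {f : Circle → E} (hf : Continuous f) :
    Integrable f μ :=
  hf.integrable_of_hasCompactSupport (HasCompactSupport.of_compactSpace f)

theorem Circle.continuous_coe_zpow (p : ℤ) : Continuous fun ζ : Circle => (ζ : ℂ) ^ p :=
  Continuous.zpow₀ (by fun_prop) p fun ζ => Or.inl ζ.coe_ne_zero

/-- Second order Taylor expansion of `ζ ^ p` at `ζ = 1` on the unit circle. -/
theorem exists_norm_zpow_taylor_le (p : ℤ) : ∃ C : ℝ, 0 ≤ C ∧ ∀ ζ : ℂ, ‖ζ‖ = 1 →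
    ‖ζ ^ p - 1 - I * p * ζ.im + (p : ℂ) ^ 2 * (1 - ζ.re)‖ ≤ C * ((1 - ζ.re) * ‖ζ - 1‖) := by
  have hsucc (ζ : ℂ) (h : ‖ζ‖ = 1) (p : ℤ) :
      ζ ^ (p + 1) - 1 - I * (p + 1 : ℤ) * ζ.im + ((p + 1 : ℤ) : ℂ) ^ 2 * (1 - ζ.re) =
        ζ * (ζ ^ p - 1 - I * p * ζ.im + (p : ℂ) ^ 2 * (1 - ζ.re))
          - (p * (p + 1) : ℂ) * ((1 - ζ.re) * (ζ - 1)) := by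
    have h0 : ζ ≠ 0 := by rintro rfl; simp at h
    rw [zpow_add_one₀ h0]
    have hsq : ζ.re ^ 2 + ζ.im ^ 2 = 1 := by
      have := Complex.sq_norm ζ
      rw [h, normSq_apply] at this; nlinarith
    have hsq' : (ζ.re : ℂ) ^ 2 + (ζ.im : ℂ) ^ 2 = 1 := by exact_mod_cast hsq
    generalize ζ ^ p = y
    push_cast
    have hζ := Complex.re_add_im ζ
    generalize (ζ.re : ℂ) = a at *
    generalize (ζ.im : ℂ) = v at *
    rw [← hζ]
    linear_combination (p : ℂ) * v ^ 2 * I_sq - (p : ℂ) * hsq'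
  have hu (ζ : ℂ) (h : ‖ζ‖ = 1) : 0 ≤ 1 - ζ.re := by
    have := Complex.re_le_norm ζ; linarith
  have hn (ζ : ℂ) (h : ‖ζ‖ = 1) (p : ℤ) :
      ‖(p * (p + 1) : ℂ) * ((1 - ζ.re) * (ζ - 1))‖ =
        |(p : ℝ) * (p + 1)| * ((1 - ζ.re) * ‖ζ - 1‖) := by
    have h1 : (p * (p + 1) : ℂ) = ((p * (p + 1) : ℝ) : ℂ) := by push_cast; rfl
    have h2 : (1 - ζ.re : ℂ) = ((1 - ζ.re : ℝ) : ℂ) := by push_cast; rfl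
    rw [norm_mul, norm_mul (1 - (ζ.re : ℂ)), h1, h2, Complex.norm_real,
      Complex.norm_real, Real.norm_eq_abs, Real.norm_eq_abs, abs_of_nonneg (hu ζ h)]
  induction p with
  | zero => exact ⟨0, le_rfl, fun ζ h => by simp⟩
  | succ p ih =>
    obtain ⟨C, hC, ih⟩ := ih
    refine ⟨C + |((p : ℤ) : ℝ) * ((p : ℤ) + 1)|, by positivity, fun ζ h => ?_⟩
    rw [hsucc ζ h]
    refine (norm_sub_le _ _).trans ?_
    rw [hn ζ h, norm_mul, h, one_mul, add_mul]
    gcongr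
    exact ih ζ h
  | pred p ih =>
    obtain ⟨C, hC, ih⟩ := ih
    refine ⟨C + |((-p - 1 : ℤ) : ℝ) * ((-p - 1 : ℤ) + 1)|, by positivity, fun ζ h => ?_⟩
    have h1 := hsucc ζ h (-p - 1)
    rw [sub_add_cancel] at h1
    have h2 := eq_add_of_sub_eq h1.symm
    have h3 := congrArg norm h2
    rw [norm_mul, h, one_mul] at h3
    rw [h3]
    refine (norm_add_le _ _).trans ?_
    rw [hn ζ h, add_mul]
    gcongr
    exact ih ζ h

theorem abs_pow_sub_one_add_mul_le (N : ℕ) {r : ℝ} (h0 : 0 ≤ r) (h1 : r ≤ 1) :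
    |r ^ N - 1 + N * (1 - r)| ≤ (N : ℝ) ^ 2 * (1 - r) ^ 2 := by
  have key : 0 ≤ r ^ N - 1 + N * (1 - r) ∧ r ^ N - 1 + N * (1 - r) ≤ (N : ℝ) ^ 2 * (1 - r) ^ 2 := by
    induction N with
    | zero => simp
    | succ N ih =>
      obtain ⟨ha, hb⟩ := ih
      have e : r ^ (N + 1) - 1 + ((N + 1 : ℕ) : ℝ) * (1 - r) =
          r * (r ^ N - 1 + N * (1 - r)) + N * (1 - r) ^ 2 := by push_cast; ring
      rw [e]
      constructor
      · positivity
      · have : r * (r ^ N - 1 + N * (1 - r)) ≤ (N : ℝ) ^ 2 * (1 - r) ^ 2 :=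
          (mul_le_of_le_one_left ha h1).trans hb
        push_cast
        have : 0 ≤ (N + 1 : ℝ) * (1 - r) ^ 2 := by positivity
        linarith
  rw [abs_of_nonneg key.1]
  exact key.2

theorem Circle.integral_one_sub_re {ν : Measure Circle} [IsProbabilityMeasure ν] {r : ℝ}
    (hr : ∫ ζ : Circle, (ζ : ℂ) ∂ν = r) : ∫ ζ : Circle, (1 - (ζ : ℂ).re) ∂ν = 1 - r := by
  have hi := Circle.integrable_of_continuous ν (f := fun ζ : Circle => (ζ : ℂ)) (by fun_prop)
  have h := integral_re hi
  simp only [RCLike.re_eq_complex_re] at h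
  rw [integral_sub (integrable_const _) (Circle.integrable_of_continuous ν (by fun_prop)), h, hr]
  simp

theorem Circle.integral_im_eq_zero {ν : Measure Circle} [IsProbabilityMeasure ν] {r : ℝ}
    (hr : ∫ ζ : Circle, (ζ : ℂ) ∂ν = r) : ∫ ζ : Circle, (ζ : ℂ).im ∂ν = 0 := by
  have h := integral_im
    (Circle.integrable_of_continuous ν (f := fun ζ : Circle => (ζ : ℂ)) (by fun_prop))
  simp only [RCLike.im_eq_complex_im] at h
  rw [h, hr, ofReal_im]

theorem Circle.integral_zpow_taylor {ν : Measure Circle} [IsProbabilityMeasure ν] {r : ℝ}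
    (hr : ∫ ζ : Circle, (ζ : ℂ) ∂ν = r) (p : ℤ) :
    ∫ ζ : Circle, ((ζ : ℂ) ^ p - 1 - I * p * (ζ : ℂ).im + (p : ℂ) ^ 2 * (1 - (ζ : ℂ).re)) ∂ν =
      (∫ ζ : Circle, (ζ : ℂ) ^ p ∂ν) - 1 + (p : ℂ) ^ 2 * (1 - r) := by
  have hp := Circle.integrable_of_continuous ν (Circle.continuous_coe_zpow p)
  have him : Integrable (fun ζ : Circle => I * p * ((ζ : ℂ).im : ℂ)) ν :=
    Circle.integrable_of_continuous ν (by fun_prop)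
  have hre : Integrable (fun ζ : Circle => (p : ℂ) ^ 2 * (1 - ((ζ : ℂ).re : ℂ))) ν :=
    Circle.integrable_of_continuous ν (by fun_prop)
  have hu : ∫ ζ : Circle, (1 - ((ζ : ℂ).re : ℂ)) ∂ν = 1 - r := by
    have := congrArg (fun x : ℝ => (x : ℂ)) (Circle.integral_one_sub_re hr)
    simp only [← integral_complex_ofReal] at this
    exact_mod_cast this
  have hv : ∫ ζ : Circle, ((ζ : ℂ).im : ℂ) ∂ν = 0 := by
    rw [integral_complex_ofReal, Circle.integral_im_eq_zero hr, ofReal_zero]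
  rw [integral_add (by exact (hp.sub (integrable_const _)).sub him) hre,
    integral_sub (by exact hp.sub (integrable_const _)) him, integral_sub hp (integrable_const _),
    integral_const_mul, integral_const_mul, hu, hv]
  simp

/-- The Fourier coefficients of a measure with real mean `r` are approximated by `r ^ p²`. -/
theorem Circle.exists_norm_integral_zpow_sub_le (p : ℤ) : ∃ C : ℝ, 0 ≤ C ∧
    ∀ (ν : Measure Circle) [IsProbabilityMeasure ν] (r : ℝ),
      ∫ ζ : Circle, (ζ : ℂ) ∂ν = r → 0 ≤ r → r ≤ 1 → ∀ ε : ℝ, 0 < ε → 1 - r ≤ ε →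
        ‖(∫ ζ : Circle, (ζ : ℂ) ^ p ∂ν) - (r : ℂ) ^ (p.natAbs ^ 2)‖ ≤
          C * (ε * (1 - r) + (∫ ζ : Circle, (1 - (ζ : ℂ).re) ^ 2 ∂ν) / ε) := by
  obtain ⟨C, hC, hT⟩ := exists_norm_zpow_taylor_le p
  set N := p.natAbs ^ 2 with hN
  have hNp : (N : ℂ) = (p : ℂ) ^ 2 := by
    have : (N : ℤ) = p ^ 2 := by rw [hN]; push_cast; exact sq_abs p
    exact_mod_cast congrArg (fun x : ℤ => (x : ℂ)) this
  refine ⟨2 * C + (N : ℝ) ^ 2, by positivity, fun ν _ r hr h0 h1 ε hε hrε => ?_⟩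
  set q := ∫ ζ : Circle, (1 - (ζ : ℂ).re) ^ 2 ∂ν with hq
  have hq0 : 0 ≤ q := integral_nonneg fun ζ => sq_nonneg _
  have hE : ‖(∫ ζ : Circle, (ζ : ℂ) ^ p ∂ν) - 1 + (p : ℂ) ^ 2 * (1 - r)‖ ≤
      C * (ε * (1 - r) + 2 * q / ε) := by
    rw [← Circle.integral_zpow_taylor hr]
    have hb : ∫ ζ : Circle, C * (ε * (1 - (ζ : ℂ).re) + 2 / ε * (1 - (ζ : ℂ).re) ^ 2) ∂ν =
        C * (ε * (1 - r) + 2 * q / ε) := by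
      rw [integral_const_mul, integral_add (Circle.integrable_of_continuous ν (by fun_prop))
        (Circle.integrable_of_continuous ν (by fun_prop)), integral_const_mul,
        integral_const_mul, Circle.integral_one_sub_re hr]
      ring
    rw [← hb]
    refine norm_integral_le_of_norm_le (Circle.integrable_of_continuous ν (by fun_prop))
      (Eventually.of_forall fun ζ => (hT ζ ζ.norm_coe).trans ?_)
    gcongr
    have hu : 0 ≤ 1 - (ζ : ℂ).re := by
      have := Complex.re_le_norm (ζ : ℂ); rw [ζ.norm_coe] at this; linarith
    have hw : ‖(ζ : ℂ) - 1‖ ^ 2 = 2 * (1 - (ζ : ℂ).re) := by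
      have h2 := Complex.sq_norm (ζ : ℂ)
      rw [ζ.norm_coe, normSq_apply] at h2
      rw [Complex.sq_norm, normSq_apply]
      simp only [sub_re, sub_im, one_re, one_im]
      nlinarith
    have hle : ‖(ζ : ℂ) - 1‖ ≤ ε + ‖(ζ : ℂ) - 1‖ ^ 2 / ε := by
      rw [← sub_le_iff_le_add', le_div_iff₀ hε]
      nlinarith [sq_nonneg (‖(ζ : ℂ) - 1‖ - ε), mul_nonneg (norm_nonneg ((ζ : ℂ) - 1)) hε.le]
    calc (1 - (ζ : ℂ).re) * ‖(ζ : ℂ) - 1‖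
        ≤ (1 - (ζ : ℂ).re) * (ε + 2 * (1 - (ζ : ℂ).re) / ε) := by
          rw [hw] at hle; gcongr
      _ = _ := by ring
  have hR : ‖(r : ℂ) ^ N - 1 + (p : ℂ) ^ 2 * (1 - r)‖ ≤ (N : ℝ) ^ 2 * (1 - r) ^ 2 := by
    have := abs_pow_sub_one_add_mul_le N h0 h1
    rw [← Real.norm_eq_abs, ← Complex.norm_real] at this
    push_cast at this
    rwa [hNp] at this
  have hsplit : (∫ ζ : Circle, (ζ : ℂ) ^ p ∂ν) - (r : ℂ) ^ N =
      ((∫ ζ : Circle, (ζ : ℂ) ^ p ∂ν) - 1 + (p : ℂ) ^ 2 * (1 - r)) -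
        ((r : ℂ) ^ N - 1 + (p : ℂ) ^ 2 * (1 - r)) := by ring
  rw [hsplit]
  refine (norm_sub_le _ _).trans ((add_le_add hE hR).trans ?_)
  have h2 : (1 - r) ^ 2 ≤ ε * (1 - r) + q / ε := by
    have : 0 ≤ q / ε := by positivity
    nlinarith
  have h3 : (N : ℝ) ^ 2 * (1 - r) ^ 2 ≤ (N : ℝ) ^ 2 * (ε * (1 - r) + q / ε) := by gcongr
  have h4 : ε * (1 - r) + 2 * q / ε ≤ 2 * (ε * (1 - r) + q / ε) := by
    have : 0 ≤ ε * (1 - r) := mul_nonneg hε.le (by linarith)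
    linarith [mul_div_assoc 2 q ε]
  have h5 := mul_le_mul_of_nonneg_left h4 hC
  linarith

theorem Circle.re_integral_sq {ν : Measure Circle} [IsProbabilityMeasure ν] {r : ℝ}
    (hr : ∫ ζ : Circle, (ζ : ℂ) ∂ν = r) :
    (∫ ζ : Circle, (ζ : ℂ) ^ 2 ∂ν).re =
      1 - 4 * (1 - r) + 2 * ∫ ζ : Circle, (1 - (ζ : ℂ).re) ^ 2 ∂ν := by
  have h := integral_re
    (Circle.integrable_of_continuous ν (f := fun ζ : Circle => (ζ : ℂ) ^ 2) (by fun_prop))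
  simp only [RCLike.re_eq_complex_re] at h
  have he (ζ : Circle) : ((ζ : ℂ) ^ 2).re =
      1 - 4 * (1 - (ζ : ℂ).re) + 2 * (1 - (ζ : ℂ).re) ^ 2 := by
    have h2 := Complex.sq_norm (ζ : ℂ)
    rw [ζ.norm_coe, normSq_apply] at h2
    rw [sq, mul_re]
    nlinarith
  rw [← h]
  simp_rw [he]
  rw [integral_add (Circle.integrable_of_continuous ν (by fun_prop))
    (Circle.integrable_of_continuous ν (by fun_prop)), integral_sub (integrable_const _)
    (Circle.integrable_of_continuous ν (by fun_prop)), integral_const_mul, integral_const_mul,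
    Circle.integral_one_sub_re hr]
  simp

theorem Circle.norm_integral_sq_sub_one_le {ν : Measure Circle} [IsProbabilityMeasure ν] {r : ℝ}
    (hr : ∫ ζ : Circle, (ζ : ℂ) ∂ν = r) :
    ‖(∫ ζ : Circle, (ζ : ℂ) ^ 2 ∂ν) - 1‖ ≤ 8 * (1 - r) := by
  have h1 := Circle.integral_zpow_taylor hr 2
  have h2 : ∫ ζ : Circle, ((ζ : ℂ) ^ 2 - 1 - 2 * I * (ζ : ℂ).im) ∂ν =
      (∫ ζ : Circle, (ζ : ℂ) ^ 2 ∂ν) - 1 := by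
    rw [integral_sub (Circle.integrable_of_continuous ν (by fun_prop))
      (Circle.integrable_of_continuous ν (by fun_prop)),
      integral_sub (Circle.integrable_of_continuous ν (by fun_prop)) (integrable_const _),
      integral_const_mul, integral_complex_ofReal, Circle.integral_im_eq_zero hr]
    simp
  rw [← h2, ← Circle.integral_one_sub_re hr, ← integral_const_mul]
  refine norm_integral_le_of_norm_le (Circle.integrable_of_continuous ν (by fun_prop))
    (Eventually.of_forall fun ζ => ?_)
  have hu : 0 ≤ 1 - (ζ : ℂ).re := by
    have := Complex.re_le_norm (ζ : ℂ); rw [ζ.norm_coe] at this; linarith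
  have hsq : ((ζ : ℂ).re : ℂ) ^ 2 + ((ζ : ℂ).im : ℂ) ^ 2 = 1 := by
    have h2 := Complex.sq_norm (ζ : ℂ)
    rw [ζ.norm_coe, normSq_apply] at h2
    norm_cast; nlinarith
  have he : (ζ : ℂ) ^ 2 - 1 - 2 * I * (ζ : ℂ).im =
      ((-2 * (1 - (ζ : ℂ).re) : ℝ) : ℂ) * (1 + ζ) := by
    have hζ := Complex.re_add_im (ζ : ℂ)
    push_cast
    generalize ((ζ : ℂ).re : ℂ) = a at *
    generalize ((ζ : ℂ).im : ℂ) = v at *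
    rw [← hζ]
    linear_combination v ^ 2 * I_sq - hsq
  rw [he, norm_mul, Complex.norm_real, Real.norm_eq_abs, abs_mul, abs_of_nonneg hu]
  have h3 : ‖1 + (ζ : ℂ)‖ ≤ 2 := by
    refine (norm_add_le _ _).trans ?_
    rw [ζ.norm_coe, norm_one]; norm_num
  norm_num
  nlinarith

theorem Circle.norm_integral_zpow_le_one (ν : Measure Circle) [IsProbabilityMeasure ν] (p : ℤ) :
    ‖∫ ζ : Circle, (ζ : ℂ) ^ p ∂ν‖ ≤ 1 := by
  have := norm_integral_le_of_norm_le_const (μ := ν) (f := fun ζ : Circle => (ζ : ℂ) ^ p) (C := 1)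
    (Eventually.of_forall fun ζ => by rw [norm_zpow, ζ.norm_coe, one_zpow])
  simpa using this

/-- Rotating a measure with nonzero mean so that its mean becomes positive. -/
theorem Circle.exists_rotation (μ : Measure Circle) [IsProbabilityMeasure μ]
    (hm : (∫ ζ : Circle, (ζ : ℂ) ∂μ) ≠ 0) :
    ∃ (ν : Measure Circle) (b : ℂ), IsProbabilityMeasure ν ∧ ‖b‖ = 1 ∧
      (∫ ζ : Circle, (ζ : ℂ) ∂ν = (‖∫ ζ : Circle, (ζ : ℂ) ∂μ‖ : ℝ)) ∧
      ∀ p : ℤ, ∫ ζ : Circle, (ζ : ℂ) ^ p ∂μ = b ^ p * ∫ ζ : Circle, (ζ : ℂ) ^ p ∂ν := by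
  set m := ∫ ζ : Circle, (ζ : ℂ) ∂μ with hmdef
  have hm' : (‖m‖ : ℂ) ≠ 0 := by exact_mod_cast norm_ne_zero_iff.2 hm
  have hb : ‖m / ‖m‖‖ = 1 := by
    rw [norm_div, Complex.norm_real, norm_norm, div_self (norm_ne_zero_iff.2 hm)]
  let b : Circle := ⟨m / ‖m‖, mem_sphere_zero_iff_norm.2 hb⟩
  have hbc : (b : ℂ) = m / ‖m‖ := rfl
  have hmeas : AEMeasurable (fun ζ : Circle => b⁻¹ * ζ) μ :=
    (continuous_const.mul continuous_id).measurable.aemeasurable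
  have hz (p : ℤ) : ∫ ζ : Circle, (ζ : ℂ) ^ p ∂(μ.map fun ζ => b⁻¹ * ζ) =
      ((b : ℂ) ^ p)⁻¹ * ∫ ζ : Circle, (ζ : ℂ) ^ p ∂μ := by
    rw [integral_map hmeas (Circle.continuous_coe_zpow p).aestronglyMeasurable,
      ← integral_const_mul]
    refine integral_congr_ae (Eventually.of_forall fun ζ => ?_)
    simp only [Circle.coe_mul, Circle.coe_inv, mul_zpow, inv_zpow]
  refine ⟨μ.map fun ζ => b⁻¹ * ζ, b, Measure.isProbabilityMeasure_map hmeas, b.norm_coe, ?_,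
    fun p => ?_⟩
  · have := hz 1
    simp only [zpow_one] at this
    rw [this, ← hmdef, hbc]
    field_simp
  · rw [hz, mul_inv_cancel_left₀ (zpow_ne_zero p b.coe_ne_zero)]

theorem Circle.two_mul_integral_sq_le {ν : Measure Circle} [IsProbabilityMeasure ν] {r : ℝ}
    (hr : ∫ ζ : Circle, (ζ : ℂ) ∂ν = r) (hr1 : r ≤ 1) {b : ℂ} (hb : ‖b‖ = 1) {δ : ℝ}
    (hr0 : 0 ≤ r) (hδ : ‖b * r - 1‖ ≤ δ) (hδ2 : δ ≤ 1 / 2) :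
    2 * ∫ ζ : Circle, (1 - (ζ : ℂ).re) ^ 2 ∂ν ≤
      ((b ^ 2 * (∫ ζ : Circle, (ζ : ℂ) ^ 2 ∂ν) - (b * r) ^ 2) / (b * r)).re +
        (2 + 61 * δ) * (1 - r) := by
  have hs := Circle.re_integral_sq hr
  have hs' := Circle.norm_integral_sq_sub_one_le hr
  set q := ∫ ζ : Circle, (1 - (ζ : ℂ).re) ^ 2 ∂ν
  set s := ∫ ζ : Circle, (ζ : ℂ) ^ 2 ∂ν
  have hbr : ‖b * r‖ = r := by
    rw [norm_mul, hb, one_mul, Complex.norm_real, Real.norm_of_nonneg hr0]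
  have hrδ : 1 - r ≤ δ := by
    have := norm_sub_norm_le (1 : ℂ) (b * r)
    rw [norm_one, hbr, norm_sub_rev] at this
    linarith
  have hrpos : 0 < r := by linarith
  have hb0 : b ≠ 0 := by rintro rfl; simp at hb
  have hrc : (r : ℂ) ≠ 0 := by exact_mod_cast hrpos.ne'
  have hbr' : ‖b - r‖ ≤ 3 * δ := by
    have h1 : b - r = (b * r - 1) + (b + 1) * ((1 - r : ℝ) : ℂ) := by push_cast; ring
    have h2 : ‖(b + 1) * ((1 - r : ℝ) : ℂ)‖ ≤ 2 * δ := by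
      rw [norm_mul, Complex.norm_real, Real.norm_of_nonneg (by linarith)]
      have : ‖b + 1‖ ≤ 2 := (norm_add_le _ _).trans (by rw [hb, norm_one]; norm_num)
      gcongr
    rw [h1]
    exact (norm_add_le _ _).trans (by linarith)
  have hsr : ‖s - (r : ℂ) ^ 2‖ ≤ 10 * (1 - r) := by
    have h1 : s - (r : ℂ) ^ 2 = (s - 1) + ((1 - r ^ 2 : ℝ) : ℂ) := by push_cast; ring
    rw [h1]
    refine (norm_add_le _ _).trans ?_
    rw [Complex.norm_real, Real.norm_of_nonneg (by nlinarith)]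
    nlinarith
  have hd : (b ^ 2 * s - (b * r) ^ 2) / (b * r) =
      (s - (r : ℂ) ^ 2) + (b - r) * ((s - (r : ℂ) ^ 2) / r) := by
    field_simp; ring
  have herr : ‖(b - r) * ((s - (r : ℂ) ^ 2) / r)‖ ≤ 60 * δ * (1 - r) := by
    have h1 : ‖(s - (r : ℂ) ^ 2) / r‖ ≤ 20 * (1 - r) := by
      rw [norm_div, Complex.norm_real, Real.norm_of_nonneg hr0, div_le_iff₀ hrpos]
      nlinarith
    rw [norm_mul]
    calc _ ≤ (3 * δ) * (20 * (1 - r)) := by gcongr; linarith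
      _ = _ := by ring
  have hre := (abs_le.1 ((Complex.abs_re_le_norm _).trans herr)).1
  have hsre : (s - (r : ℂ) ^ 2).re = s.re - r ^ 2 := by
    rw [sub_re]; norm_cast
  rw [hd, add_re, hsre, hs]
  nlinarith [mul_le_mul_of_nonneg_right hrδ (by linarith : 0 ≤ 1 - r)]

/-- The Cauchy-type transform `∫ ζ / (1 - ζ z) dμ`. -/
def cauchyT (μ : Measure Circle) (z : ℂ) : ℂ :=
  ∫ ζ : Circle, (ζ : ℂ) / (1 - (ζ : ℂ) * z) ∂μ

theorem one_sub_norm_le_norm_one_sub (ζ : Circle) (z : ℂ) : 1 - ‖z‖ ≤ ‖1 - (ζ : ℂ) * z‖ := by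
  have := norm_sub_norm_le (1 : ℂ) (ζ * z)
  rwa [norm_one, norm_mul, ζ.norm_coe, one_mul] at this

theorem one_sub_mul_ne_zero (ζ : Circle) {z : ℂ} (hz : ‖z‖ < 1) : 1 - (ζ : ℂ) * z ≠ 0 := by
  have := one_sub_norm_le_norm_one_sub ζ z
  exact norm_pos_iff.1 (by linarith)

theorem hasDerivAt_cauchyT (μ : Measure Circle) [IsProbabilityMeasure μ] {z : ℂ}
    (hz : ‖z‖ < 1 / 2) :
    HasDerivAt (cauchyT μ) (∫ ζ : Circle, (ζ : ℂ) ^ 2 / (1 - (ζ : ℂ) * z) ^ 2 ∂μ) z := by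
  have hball : ball (0 : ℂ) (1 / 2) ∈ 𝓝 z := isOpen_ball.mem_nhds (by simpa using hz)
  have hlt {w : ℂ} (hw : w ∈ ball (0 : ℂ) (1 / 2)) : ‖w‖ < 1 / 2 := by simpa using hw
  have hcont {w : ℂ} (hw : ‖w‖ < 1 / 2) :
      Continuous fun ζ : Circle => (ζ : ℂ) / (1 - (ζ : ℂ) * w) :=
    Continuous.div (by fun_prop) (by fun_prop) fun ζ => one_sub_mul_ne_zero ζ (by linarith)
  have hcont' : Continuous fun ζ : Circle => (ζ : ℂ) ^ 2 / (1 - (ζ : ℂ) * z) ^ 2 :=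
    Continuous.div (by fun_prop) (by fun_prop)
      fun ζ => pow_ne_zero 2 (one_sub_mul_ne_zero ζ (by linarith))
  refine (hasDerivAt_integral_of_dominated_loc_of_deriv_le (bound := fun _ => 4)
    (F := fun w (ζ : Circle) => (ζ : ℂ) / (1 - (ζ : ℂ) * w))
    (F' := fun w (ζ : Circle) => (ζ : ℂ) ^ 2 / (1 - (ζ : ℂ) * w) ^ 2) hball
    (by filter_upwards [hball] with w hw using (hcont (hlt hw)).aestronglyMeasurable)
    (Circle.integrable_of_continuous μ (hcont hz)) hcont'.aestronglyMeasurable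
    (Eventually.of_forall fun ζ w hw => ?_) (integrable_const _)
    (Eventually.of_forall fun ζ w hw => ?_)).2
  · have h1 := one_sub_norm_le_norm_one_sub ζ w
    have h2 := hlt hw
    rw [norm_div, norm_pow, norm_pow, ζ.norm_coe, one_pow, div_le_iff₀ (by nlinarith)]
    nlinarith
  · have h0 := one_sub_mul_ne_zero ζ (by linarith [hlt hw] : ‖w‖ < 1)
    have h1 : HasDerivAt (fun w => 1 - (ζ : ℂ) * w) (-(ζ : ℂ)) w := by
      simpa using ((hasDerivAt_id w).const_mul (ζ : ℂ)).const_sub 1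
    refine ((hasDerivAt_const w (ζ : ℂ)).div h1 h0).congr_deriv ?_
    ring

theorem norm_cauchyT_le (μ : Measure Circle) [IsProbabilityMeasure μ] {z : ℂ}
    (hz : ‖z‖ < 1 / 2) : ‖cauchyT μ z‖ ≤ 2 := by
  have := norm_integral_le_of_norm_le_const (μ := μ) (C := 2)
    (f := fun ζ : Circle => (ζ : ℂ) / (1 - (ζ : ℂ) * z)) (Eventually.of_forall fun ζ => by
      have h1 := one_sub_norm_le_norm_one_sub ζ z
      rw [norm_div, ζ.norm_coe, div_le_iff₀ (by linarith)]
      linarith)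
  simpa [cauchyT] using this

theorem one_add_mul_cauchyT_ne_zero (μ : Measure Circle) [IsProbabilityMeasure μ] {z : ℂ}
    (hz : ‖z‖ < 1 / 2) : 1 + z * cauchyT μ z ≠ 0 := by
  intro h
  have h1 : z * cauchyT μ z = -1 := by linear_combination h
  have h2 := congrArg norm h1
  rw [norm_mul, norm_neg, norm_one] at h2
  have h3 := norm_cauchyT_le μ hz
  nlinarith [norm_nonneg z, norm_nonneg (cauchyT μ z)]

theorem BT_eq_cauchyT_div (μ : Measure Circle) (z : ℂ) :
    BT μ z = cauchyT μ z / (1 + z * cauchyT μ z) := by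
  have hpsi : psiT μ z = z * cauchyT μ z := by
    rw [psiT, cauchyT, ← integral_const_mul]
    refine integral_congr_ae (Eventually.of_forall fun ζ => ?_)
    simp only
    ring
  unfold BT
  split_ifs with h
  · simp [h, cauchyT]
  · rw [hpsi, mul_div_assoc, inv_mul_cancel_left₀ h]

theorem hasDerivAt_BT (μ : Measure Circle) [IsProbabilityMeasure μ] {z : ℂ}
    (hz : ‖z‖ < 1 / 2) :
    HasDerivAt (BT μ) (((∫ ζ : Circle, (ζ : ℂ) ^ 2 / (1 - (ζ : ℂ) * z) ^ 2 ∂μ)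
      - cauchyT μ z ^ 2) / (1 + z * cauchyT μ z) ^ 2) z := by
  have hF := hasDerivAt_cauchyT μ hz
  have h := hF.div (((hasDerivAt_id z).mul hF).const_add 1) (one_add_mul_cauchyT_ne_zero μ hz)
  rw [funext (BT_eq_cauchyT_div μ)]
  refine h.congr_deriv ?_
  simp only [id, Pi.mul_apply]
  ring

theorem BT_zero (μ : Measure Circle) : BT μ 0 = ∫ ζ : Circle, (ζ : ℂ) ∂μ := if_pos rfl

theorem logDeriv_BT_zero (μ : Measure Circle) [IsProbabilityMeasure μ] :
    logDeriv (BT μ) 0 = ((∫ ζ : Circle, (ζ : ℂ) ^ 2 ∂μ) - (∫ ζ : Circle, (ζ : ℂ) ∂μ) ^ 2) /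
      ∫ ζ : Circle, (ζ : ℂ) ∂μ := by
  rw [logDeriv_apply, BT_zero, (hasDerivAt_BT μ (z := 0) (by norm_num)).deriv]
  simp [cauchyT]

theorem IsInfinitesimalArrayT.eventually_norm_integral_sub_one_le {kn : ℕ → ℕ}
    {μ : ℕ → ℕ → Measure Circle} (hprob : ∀ n i, IsProbabilityMeasure (μ n i))
    (hinf : IsInfinitesimalArrayT kn μ) {δ : ℝ} (hδ : 0 < δ) :
    ∀ᶠ n in atTop, ∀ i < kn n, ‖(∫ ζ : Circle, (ζ : ℂ) ∂(μ n i)) - 1‖ ≤ δ := by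
  obtain ⟨N, hN⟩ := hinf (δ / 2) (by positivity) (ENNReal.ofReal (δ / 4)) (by simpa using hδ)
  filter_upwards [eventually_ge_atTop N] with n hn i hi
  have hlt := hN n hn i hi
  have := hprob n i
  set A : Set Circle := {ζ | δ / 2 ≤ ‖(ζ : ℂ) - 1‖} with hA
  have hAm : MeasurableSet A :=
    (isClosed_le continuous_const (by fun_prop)).measurableSet
  have hAr : (μ n i).real A ≤ δ / 4 :=
    ENNReal.toReal_le_of_le_ofReal (by positivity) hlt.le
  have e : (∫ ζ : Circle, (ζ : ℂ) ∂(μ n i)) - 1 = ∫ ζ : Circle, ((ζ : ℂ) - 1) ∂(μ n i) := by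
    rw [integral_sub (Circle.integrable_of_continuous _ (by fun_prop)) (integrable_const _)]
    simp
  rw [e]
  have hint : Integrable (A.indicator fun _ => (2 : ℝ)) (μ n i) :=
    (integrable_const _).indicator hAm
  refine (norm_integral_le_of_norm_le (g := fun ζ => δ / 2 + A.indicator (fun _ => (2 : ℝ)) ζ)
    ((integrable_const _).add hint) (Eventually.of_forall fun ζ => ?_)).trans ?_
  · by_cases h : ζ ∈ A
    · rw [Set.indicator_of_mem h]
      have := norm_sub_le (ζ : ℂ) 1
      rw [ζ.norm_coe, norm_one] at this
      linarith
    · rw [Set.indicator_of_notMem h]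
      have : ‖(ζ : ℂ) - 1‖ < δ / 2 := not_le.1 h
      linarith
  · rw [integral_add (integrable_const _) hint, integral_indicator_const _ hAm]
    simp only [integral_const, probReal_univ, smul_eq_mul]
    linarith

theorem norm_prod_sub_prod_le_sum {ι : Type*} (s : Finset ι) (x y : ι → ℂ)
    (hx : ∀ i ∈ s, ‖x i‖ ≤ 1) (hy : ∀ i ∈ s, ‖y i‖ ≤ 1) :
    ‖∏ i ∈ s, x i - ∏ i ∈ s, y i‖ ≤ ∑ i ∈ s, ‖x i - y i‖ := by
  classical
  induction s using Finset.induction_on with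
  | empty => simp
  | insert a s ha ih =>
    rw [Finset.prod_insert ha, Finset.prod_insert ha, Finset.sum_insert ha]
    have ih' := ih (fun i hi => hx i (Finset.mem_insert_of_mem hi))
      fun i hi => hy i (Finset.mem_insert_of_mem hi)
    have e : x a * ∏ i ∈ s, x i - y a * ∏ i ∈ s, y i =
        (x a - y a) * ∏ i ∈ s, x i + y a * (∏ i ∈ s, x i - ∏ i ∈ s, y i) := by ring
    have hP : ‖∏ i ∈ s, x i‖ ≤ 1 := by
      rw [norm_prod]
      exact Finset.prod_le_one (fun _ _ => norm_nonneg _)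
        fun i hi => hx i (Finset.mem_insert_of_mem hi)
    rw [e]
    refine (norm_add_le _ _).trans (add_le_add ?_ ?_)
    · rw [norm_mul]
      exact mul_le_of_le_one_right (norm_nonneg _) hP
    · rw [norm_mul]
      exact (mul_le_of_le_one_left (norm_nonneg _) (hy a (Finset.mem_insert_self a s))).trans ih'

/-- Corollary 4.2, boolean ⇒ classical: if the boolean convolutions converge weakly to the
⨃-normal law with parameters γ, σ = (t/2)δ₁, then the classical convolutions
δ_{λ_n} ⊛ μ_{n1} ⊛ ⋯ ⊛ μ_{nk_n} converge weakly to the normal distribution on 𝕋 with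
Fourier coefficients γ^p e^{−tp²/2}. -/
theorem stmt11
    (kn : ℕ → ℕ) (μ : ℕ → ℕ → Measure Circle)
    (hprob : ∀ n i, IsProbabilityMeasure (μ n i))
    (hinf : IsInfinitesimalArrayT kn μ)
    (hmom : ∀ n : ℕ, ∀ i < kn n, (∫ ζ : Circle, (ζ : ℂ) ∂(μ n i)) ≠ 0)
    (lam : ℕ → Circle)
    (γ : Circle) (t : ℝ) (ht : 0 < t)
    (hconv : ∀ K : Set ℂ, K ⊆ ball (0:ℂ) 1 → IsCompact K →
      TendstoUniformlyOn
        (fun n z => ((lam n : ℂ)) * ∏ i ∈ Finset.range (kn n), BT (μ n i) z)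
        (fun z => (γ : ℂ) * Complex.exp (-((t : ℂ) / 2) * ((1 + z) / (1 - z))))
        atTop K) :
    ∀ p : ℤ, Tendsto
      (fun n => ((lam n : ℂ)) ^ p *
        ∏ i ∈ Finset.range (kn n), ∫ ζ : Circle, (ζ : ℂ) ^ p ∂(μ n i))
      atTop (𝓝 ((γ : ℂ) ^ p * Complex.exp (-(t : ℂ) * (p : ℂ) ^ 2 / 2))) := by
  have hball : ball (0 : ℂ) (1 / 2) ⊆ ball 0 1 := ball_subset_ball (by norm_num)
  have h0mem : (0 : ℂ) ∈ ball (0 : ℂ) (1 / 2) := mem_ball_self (by norm_num)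
  have hnorm_lt {z : ℂ} (hz : z ∈ ball (0 : ℂ) (1 / 2)) : ‖z‖ < 1 / 2 := by simpa using hz
  have hloc : TendstoLocallyUniformlyOn
      (fun n z => ((lam n : ℂ)) * ∏ i ∈ Finset.range (kn n), BT (μ n i) z)
      (fun z => (γ : ℂ) * Complex.exp (-((t : ℂ) / 2) * ((1 + z) / (1 - z))))
      atTop (ball (0 : ℂ) (1 / 2)) :=
    (tendstoLocallyUniformlyOn_iff_forall_isCompact isOpen_ball).2
      fun K hK hKc => hconv K (hK.trans hball) hKc
  have hdiffB (n i : ℕ) : DifferentiableOn ℂ (BT (μ n i)) (ball 0 (1 / 2)) := fun z hz => by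
    have := hprob n i
    exact (hasDerivAt_BT (μ n i) (hnorm_lt hz)).differentiableAt.differentiableWithinAt
  have hval := hloc.tendsto_at h0mem
  have hder := (hloc.deriv (Eventually.of_forall fun n => (DifferentiableOn.fun_finsetProd
    fun i _ => hdiffB n i).const_mul (lam n : ℂ)) isOpen_ball).tendsto_at h0mem
  have hexp : HasDerivAt
      (fun z : ℂ => (γ : ℂ) * Complex.exp (-((t : ℂ) / 2) * ((1 + z) / (1 - z))))
      ((γ : ℂ) * (Complex.exp (-((t : ℂ) / 2) * ((1 + 0) / (1 - 0))) * (-t))) 0 := by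
    have h1 : HasDerivAt (fun z : ℂ => (1 + z) / (1 - z))
        ((1 * (1 - 0) - (1 + 0) * -1) / (1 - 0) ^ 2) 0 :=
      ((hasDerivAt_id (0 : ℂ)).const_add 1).div ((hasDerivAt_id (0 : ℂ)).const_sub 1) (by simp)
    refine (((h1.const_mul (-((t : ℂ) / 2))).cexp).const_mul (γ : ℂ)).congr_deriv ?_
    norm_num
  simp only [Function.comp_apply] at hder
  rw [hexp.deriv] at hder
  have hlog : Tendsto (fun n => ∑ i ∈ Finset.range (kn n),
      ((∫ ζ : Circle, (ζ : ℂ) ^ 2 ∂(μ n i)) - (∫ ζ : Circle, (ζ : ℂ) ∂(μ n i)) ^ 2) /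
        ∫ ζ : Circle, (ζ : ℂ) ∂(μ n i)) atTop (𝓝 (-(t : ℂ))) := by
    have h := hder.div hval (mul_ne_zero γ.coe_ne_zero (Complex.exp_ne_zero _))
    rw [← mul_assoc, mul_div_cancel_left₀ _
      (mul_ne_zero γ.coe_ne_zero (Complex.exp_ne_zero _))] at h
    refine h.congr fun n => ?_
    rw [Pi.div_apply]
    refine (logDeriv_apply _ _).symm.trans ?_
    rw [logDeriv_const_mul _ _ (lam n).coe_ne_zero, logDeriv_prod
      (fun i hi => by rw [BT_zero]; exact hmom n i (Finset.mem_range.1 hi))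
      fun i _ => (hdiffB n i).differentiableAt (isOpen_ball.mem_nhds h0mem)]
    refine Finset.sum_congr rfl fun i _ => ?_
    have := hprob n i
    exact logDeriv_BT_zero (μ n i)
  simp only [BT_zero, add_zero, sub_zero, div_one, mul_one] at hval
  set m : ℕ → ℕ → ℂ := fun n i => ∫ ζ : Circle, (ζ : ℂ) ∂(μ n i) with hm
  have hprod : Tendsto (fun n => ∏ i ∈ Finset.range (kn n), ‖m n i‖) atTop
      (𝓝 (Real.exp (-(t / 2)))) := by
    have h := hval.norm
    simp only [norm_mul, Circle.norm_coe, one_mul, norm_prod, Complex.norm_exp] at h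
    simpa using h
  have hm1 (n i : ℕ) : ‖m n i‖ ≤ 1 := by
    have := hprob n i
    simpa [hm] using Circle.norm_integral_zpow_le_one (μ n i) 1
  have hclose (δ : ℝ) (hδ : 0 < δ) : ∀ᶠ n in atTop, ∀ i < kn n, ‖m n i - 1‖ ≤ δ :=
    hinf.eventually_norm_integral_sub_one_le hprob hδ
  have hrot (n i : ℕ) : ∃ (ν : Measure Circle) (b : ℂ), i < kn n →
      IsProbabilityMeasure ν ∧ ‖b‖ = 1 ∧ (∫ ζ : Circle, (ζ : ℂ) ∂ν = (‖m n i‖ : ℝ)) ∧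
      ∀ p : ℤ, ∫ ζ : Circle, (ζ : ℂ) ^ p ∂(μ n i) = b ^ p * ∫ ζ : Circle, (ζ : ℂ) ^ p ∂ν := by
    have := hprob n i
    by_cases hi : i < kn n
    · obtain ⟨ν, b, h⟩ := Circle.exists_rotation (μ n i) (hmom n i hi)
      exact ⟨ν, b, fun _ => h⟩
    · exact ⟨0, 0, fun h => absurd h hi⟩
  choose ν b hνb using hrot
  have hmb (n i : ℕ) (hi : i < kn n) : m n i = b n i * (‖m n i‖ : ℝ) := by
    obtain ⟨-, -, h1, h2⟩ := hνb n i hi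
    simpa [hm, h1] using h2 1
  set q : ℕ → ℕ → ℝ := fun n i => ∫ ζ : Circle, (1 - (ζ : ℂ).re) ^ 2 ∂(ν n i) with hq
  have hell : Tendsto (fun n => -Real.log (∏ i ∈ Finset.range (kn n), ‖m n i‖)) atTop
      (𝓝 (t / 2)) := by
    have := (hprod.log (Real.exp_pos _).ne').neg
    rwa [Real.log_exp, neg_neg] at this
  have hSell (n : ℕ) : ∑ i ∈ Finset.range (kn n), (1 - ‖m n i‖) ≤
      -Real.log (∏ i ∈ Finset.range (kn n), ‖m n i‖) := by
    have hpos (i : ℕ) (hi : i ∈ Finset.range (kn n)) : 0 < ‖m n i‖ :=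
      norm_pos_iff.2 (hmom n i (Finset.mem_range.1 hi))
    rw [Real.log_prod fun i hi => (hpos i hi).ne', ← Finset.sum_neg_distrib]
    refine Finset.sum_le_sum fun i hi => ?_
    have := Real.log_le_sub_one_of_pos (hpos i hi)
    linarith
  have hQ (η : ℝ) (hη : 0 < η) : ∀ᶠ n in atTop, ∑ i ∈ Finset.range (kn n), q n i ≤ η := by
    set δ : ℝ := min (1 / 2) (η / (31 * t)) with hδ
    have hδ0 : 0 < δ := by positivity
    have hδη : δ * (31 * t) ≤ η := by
      rw [← le_div_iff₀ (by positivity)]; exact min_le_right _ _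
    have hlim := ((Complex.continuous_re.tendsto _).comp hlog).add (hell.const_mul (2 + 61 * δ))
    have hlt : (-(t : ℂ)).re + (2 + 61 * δ) * (t / 2) < 2 * η := by
      rw [neg_re, ofReal_re]
      nlinarith
    filter_upwards [hlim.eventually_lt_const hlt, hclose δ hδ0] with n hn hc
    have hle : 2 * ∑ i ∈ Finset.range (kn n), q n i ≤
        (∑ i ∈ Finset.range (kn n), ((∫ ζ : Circle, (ζ : ℂ) ^ 2 ∂(μ n i)) - m n i ^ 2) /
          m n i).re + (2 + 61 * δ) * ∑ i ∈ Finset.range (kn n), (1 - ‖m n i‖) := by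
      rw [Complex.re_sum, Finset.mul_sum, Finset.mul_sum, ← Finset.sum_add_distrib]
      refine Finset.sum_le_sum fun i hi => ?_
      have hi := Finset.mem_range.1 hi
      obtain ⟨h1, h2, h3, h4⟩ := hνb n i hi
      have h5 := Circle.two_mul_integral_sq_le h3 (hm1 n i) h2 (norm_nonneg _)
        (by rw [← hmb n i hi]; exact hc i hi) (min_le_left _ _)
      rw [← hmb n i hi] at h5
      have h6 : ∫ ζ : Circle, (ζ : ℂ) ^ 2 ∂(μ n i) =
          b n i ^ 2 * ∫ ζ : Circle, (ζ : ℂ) ^ 2 ∂(ν n i) := by exact_mod_cast h4 2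
      rwa [h6]
    have h7 := mul_le_mul_of_nonneg_left (hSell n) (by positivity : 0 ≤ 2 + 61 * δ)
    simp only [Function.comp_apply] at hn
    linarith
  intro p
  obtain ⟨C, hC, hCp⟩ := Circle.exists_norm_integral_zpow_sub_le p
  set N := p.natAbs ^ 2 with hN
  have hdiff : Tendsto (fun n => ∏ i ∈ Finset.range (kn n), (∫ ζ : Circle, (ζ : ℂ) ^ p ∂(ν n i))
      - ∏ i ∈ Finset.range (kn n), ((‖m n i‖ : ℝ) : ℂ) ^ N) atTop (𝓝 0) := by
    rw [Metric.tendsto_nhds]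
    intro e he
    set ε : ℝ := e / (C * (t + 1) + 1) with hε
    have hden : 0 < C * (t + 1) + 1 := by positivity
    have hε0 : 0 < ε := by positivity
    have hεe : ε * (C * (t + 1) + 1) = e := div_mul_cancel₀ _ hden.ne'
    filter_upwards [hclose ε hε0, hQ (ε ^ 2) (by positivity),
      hell.eventually_le_const (by linarith : t / 2 < t)] with n hc hQn hS
    rw [dist_zero_right]
    have hle : ∑ i ∈ Finset.range (kn n), ‖(∫ ζ : Circle, (ζ : ℂ) ^ p ∂(ν n i)) -
        ((‖m n i‖ : ℝ) : ℂ) ^ N‖ ≤ C * (ε * ∑ i ∈ Finset.range (kn n), (1 - ‖m n i‖) +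
          (∑ i ∈ Finset.range (kn n), q n i) / ε) := by
      rw [Finset.mul_sum, Finset.sum_div, ← Finset.sum_add_distrib, Finset.mul_sum]
      refine Finset.sum_le_sum fun i hi => ?_
      have hi := Finset.mem_range.1 hi
      obtain ⟨h1, h2, h3, h4⟩ := hνb n i hi
      refine hCp (ν n i) _ h3 (norm_nonneg _) (hm1 n i) ε hε0 ?_
      have h5 := norm_sub_norm_le (1 : ℂ) (m n i)
      rw [norm_one, norm_sub_rev] at h5
      exact h5.trans (hc i hi)
    have hbound : C * (ε * ∑ i ∈ Finset.range (kn n), (1 - ‖m n i‖) +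
          (∑ i ∈ Finset.range (kn n), q n i) / ε) ≤ C * (ε * t + ε) := by
      have h1 : (∑ i ∈ Finset.range (kn n), q n i) / ε ≤ ε := by
        rw [div_le_iff₀ hε0, ← sq]; exact hQn
      have h2 := (hSell n).trans hS
      gcongr
    refine ((norm_prod_sub_prod_le_sum _ _ _ (fun i hi => ?_) fun i _ => ?_).trans
      (hle.trans hbound)).trans_lt (by linarith)
    · have := (hνb n i (Finset.mem_range.1 hi)).1
      exact Circle.norm_integral_zpow_le_one (ν n i) p
    · rw [norm_pow, Complex.norm_real, norm_norm]
      exact pow_le_one₀ (norm_nonneg _) (hm1 n i)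
  have hprodC : Tendsto (fun n => ∏ i ∈ Finset.range (kn n), ((‖m n i‖ : ℝ) : ℂ)) atTop
      (𝓝 (Real.exp (-(t / 2)) : ℝ)) := by
    have := (Complex.continuous_ofReal.tendsto _).comp hprod
    simpa only [Function.comp_def, ofReal_prod] using this
  have hc : Tendsto (fun n => ∏ i ∈ Finset.range (kn n), ∫ ζ : Circle, (ζ : ℂ) ^ p ∂(ν n i))
      atTop (𝓝 (Complex.exp (-(t : ℂ) * (p : ℂ) ^ 2 / 2))) := by
    have h := hdiff.add (hprodC.pow N)
    have e1 : (0 : ℂ) + ((Real.exp (-(t / 2)) : ℝ) : ℂ) ^ N =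
        Complex.exp (-(t : ℂ) * (p : ℂ) ^ 2 / 2) := by
      have hNp : (N : ℂ) = (p : ℂ) ^ 2 := by
        have : (N : ℤ) = p ^ 2 := by rw [hN]; push_cast; exact sq_abs p
        exact_mod_cast congrArg (fun x : ℤ => (x : ℂ)) this
      rw [zero_add, ofReal_exp, ← Complex.exp_nat_mul, hNp]
      congr 1
      push_cast
      ring
    rw [e1] at h
    refine h.congr fun n => ?_
    rw [Finset.prod_pow, sub_add_cancel]
  have hbprod : Tendsto (fun n => (lam n : ℂ) * ∏ i ∈ Finset.range (kn n), b n i) atTop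
      (𝓝 (γ : ℂ)) := by
    have hne : ((Real.exp (-(t / 2)) : ℝ) : ℂ) ≠ 0 := by exact_mod_cast (Real.exp_pos _).ne'
    have h := hval.div hprodC hne
    have e1 : (γ : ℂ) * Complex.exp (-((t : ℂ) / 2)) / (Real.exp (-(t / 2)) : ℝ) = γ := by
      rw [div_eq_iff hne]; push_cast; rfl
    rw [e1] at h
    refine h.congr fun n => ?_
    rw [Pi.div_apply, div_eq_iff (Finset.prod_ne_zero_iff.2 fun i hi => by
      exact_mod_cast norm_ne_zero_iff.2 (hmom n i (Finset.mem_range.1 hi))), mul_assoc,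
      ← Finset.prod_mul_distrib]
    congr 1
    exact Finset.prod_congr rfl fun i hi => hmb n i (Finset.mem_range.1 hi)
  refine ((hbprod.zpow₀ p (Or.inl γ.coe_ne_zero)).mul hc).congr fun n => ?_
  rw [mul_zpow, mul_assoc, ← Finset.prod_zpow, ← Finset.prod_mul_distrib]
  congr 1
  exact Finset.prod_congr rfl fun i hi => ((hνb n i (Finset.mem_range.1 hi)).2.2.2 p).symm

end
end

section
/- Let {μ_{nk}} be an infinitesimal array of probability measures on 𝕋, each with nonzero first moment, and let {λ_n}_{n≥1} ⊂ 𝕋. Suppose there exist γ ∈ 𝕋 and t > 0 such that for every p ∈ ℤ, lim_{n→∞} λ_n^p · Π_{k=1}^{k_n} ∫_𝕋 ζ^p dμ_{nk}(ζ) = γ^p·exp(−t p²/2) (i.e., the classical convolutions δ_{λ_n} ⊛ μ_{n1} ⊛ ⋯ ⊛ μ_{nk_n} converge weakly to a normal distribution on 𝕋). Then λ_n · Π_{k=1}^{k_n} B_{μ_{nk}}(z) converges to γ·exp(−(t/2)(1+z)/(1−z)) uniformly on compact subsets of 𝔻; i.e., the boolean convolutions δ_{λ_n} ⨃ μ_{n1}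 ⨃ ⋯ ⨃ μ_{nk_n} converge weakly to the ⨃-normal distribution with parameters γ and σ = (t/2)δ₁. -/
open MeasureTheory Complex Filter Topology Metric

noncomputable section

lemma integrable_circle_of_continuous (μ : Measure Circle) [IsProbabilityMeasure μ]
    {E : Type*} [NormedAddCommGroup E] {f : Circle → E} (hf : Continuous f) : Integrable f μ :=
  hf.integrable_of_hasCompactSupport (HasCompactSupport.of_compactSpace f)

/-- The first moment of a measure on the circle. -/
def circleMean (μ : Measure Circle) : ℂ := ∫ ζ : Circle, (ζ : ℂ) ∂μ

/-- The second moment about the mean, without absolute value. -/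
def circlePseudoVar (μ : Measure Circle) : ℂ := ∫ ζ : Circle, ((ζ : ℂ) - circleMean μ) ^ 2 ∂μ

/-- The absolute central moment of order `p`. -/
def circleAbsMoment (p : ℕ) (μ : Measure Circle) : ℝ :=
  ∫ ζ : Circle, ‖(ζ : ℂ) - circleMean μ‖ ^ p ∂μ

/-- The second-order remainder in the expansion of `∫ 1 / (1 - ζ z)` about the mean. -/
def circleRemainder (μ : Measure Circle) (z : ℂ) : ℂ :=
  ∫ ζ : Circle, ((ζ : ℂ) - circleMean μ) ^ 2 / (1 - (ζ : ℂ) * z) ∂μ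

lemma circleAbsMoment_nonneg (p : ℕ) (μ : Measure Circle) : 0 ≤ circleAbsMoment p μ :=
  integral_nonneg fun _ => by positivity

lemma norm_circlePseudoVar_le (μ : Measure Circle) : ‖circlePseudoVar μ‖ ≤ circleAbsMoment 2 μ := by
  refine (norm_integral_le_integral_norm _).trans_eq ?_
  simp [circleAbsMoment]

section SingleMeasure

variable (μ : Measure Circle) [IsProbabilityMeasure μ]

lemma norm_circleMean_le_one : ‖circleMean μ‖ ≤ 1 := by
  have := norm_integral_le_of_norm_le_const (μ := μ) (f := fun ζ : Circle => (ζ : ℂ)) (C := 1)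
    (ae_of_all _ fun ζ => (Circle.norm_coe ζ).le)
  simpa [circleMean] using this

lemma integral_sub_circleMean : ∫ ζ : Circle, ((ζ : ℂ) - circleMean μ) ∂μ = 0 := by
  rw [integral_sub (integrable_circle_of_continuous μ (by fun_prop)) (integrable_const _)]
  simp [circleMean]

lemma circlePseudoVar_eq :
    circlePseudoVar μ = (∫ ζ : Circle, (ζ : ℂ) ^ 2 ∂μ) - circleMean μ ^ 2 := by
  have h : ∀ ζ : Circle, ((ζ : ℂ) - circleMean μ) ^ 2
      = (ζ : ℂ) ^ 2 - circleMean μ ^ 2 - 2 * circleMean μ * ((ζ : ℂ) - circleMean μ) := by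
    intro ζ; ring
  unfold circlePseudoVar
  simp_rw [h]
  rw [integral_sub (integrable_circle_of_continuous μ (by fun_prop))
      (integrable_circle_of_continuous μ (by fun_prop)),
    integral_sub (integrable_circle_of_continuous μ (by fun_prop)) (integrable_const _),
    integral_const_mul, integral_sub_circleMean]
  simp

lemma norm_sub_sq_circle (m : ℂ) (ζ : Circle) :
    ‖(ζ : ℂ) - m‖ ^ 2 = (1 - ‖m‖ ^ 2) - 2 * (starRingEnd ℂ m * ((ζ : ℂ) - m)).re := by
  have h : ‖(ζ : ℂ)‖ ^ 2 = 1 := by rw [Circle.norm_coe, one_pow]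
  rw [← Complex.normSq_eq_norm_sq, Complex.normSq_apply] at h
  simp only [← Complex.normSq_eq_norm_sq, Complex.normSq_apply, sub_re, sub_im, mul_re, conj_re,
    conj_im]
  linear_combination h

lemma integral_re_conj_mul_sub :
    ∫ ζ : Circle, (starRingEnd ℂ (circleMean μ) * ((ζ : ℂ) - circleMean μ)).re ∂μ = 0 := by
  have h := integral_re (𝕜 := ℂ) (μ := μ)
    (f := fun ζ : Circle => starRingEnd ℂ (circleMean μ) * ((ζ : ℂ) - circleMean μ))
    (integrable_circle_of_continuous μ (by fun_prop))
  simp only [RCLike.re_eq_complex_re] at h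
  rw [h, integral_const_mul, integral_sub_circleMean]
  simp

lemma circleAbsMoment_two : circleAbsMoment 2 μ = 1 - ‖circleMean μ‖ ^ 2 := by
  unfold circleAbsMoment
  simp_rw [norm_sub_sq_circle (circleMean μ)]
  rw [integral_sub (integrable_const _) (integrable_circle_of_continuous μ (by fun_prop)),
    integral_const_mul, integral_re_conj_mul_sub]
  simp

lemma circleAbsMoment_four :
    circleAbsMoment 4 μ = (1 - ‖circleMean μ‖ ^ 2) ^ 2
      + 2 * ‖circleMean μ‖ ^ 2 * (1 - ‖circleMean μ‖ ^ 2)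
      + 2 * (starRingEnd ℂ (circleMean μ) ^ 2 * circlePseudoVar μ).re := by
  set m := circleMean μ with hm
  have h : ∀ ζ : Circle, ‖(ζ : ℂ) - m‖ ^ 4 = (1 - ‖m‖ ^ 2) ^ 2
      - 4 * (1 - ‖m‖ ^ 2) * (starRingEnd ℂ m * ((ζ : ℂ) - m)).re
      + 2 * ‖m‖ ^ 2 * ‖(ζ : ℂ) - m‖ ^ 2
      + 2 * (starRingEnd ℂ m ^ 2 * ((ζ : ℂ) - m) ^ 2).re := by
    intro ζ
    have h1 : (starRingEnd ℂ m ^ 2 * ((ζ : ℂ) - m) ^ 2).re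
        = 2 * (starRingEnd ℂ m * ((ζ : ℂ) - m)).re ^ 2 - ‖m‖ ^ 2 * ‖(ζ : ℂ) - m‖ ^ 2 := by
      rw [← mul_pow, ← mul_pow, ← RCLike.norm_conj m, ← norm_mul,
        ← Complex.normSq_eq_norm_sq, Complex.normSq_apply, sq (_ * _ : ℂ), mul_re]
      ring
    have h2 := norm_sub_sq_circle m ζ
    rw [h1]
    have h3 : ‖(ζ : ℂ) - m‖ ^ 4 = (‖(ζ : ℂ) - m‖ ^ 2) ^ 2 := by ring
    rw [h3, h2]; ring
  have hV := integral_re (𝕜 := ℂ) (μ := μ)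
    (f := fun ζ : Circle => starRingEnd ℂ m ^ 2 * ((ζ : ℂ) - m) ^ 2)
    (integrable_circle_of_continuous μ (by fun_prop))
  simp only [RCLike.re_eq_complex_re] at hV
  rw [integral_const_mul] at hV
  have h2 := circleAbsMoment_two μ
  unfold circleAbsMoment at h2 ⊢
  simp_rw [← hm] at h2 ⊢
  simp_rw [h]
  rw [integral_add (integrable_circle_of_continuous μ (by fun_prop))
      (integrable_circle_of_continuous μ (by fun_prop)),
    integral_add (integrable_circle_of_continuous μ (by fun_prop))
      (integrable_circle_of_continuous μ (by fun_prop)),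
    integral_sub (integrable_const _) (integrable_circle_of_continuous μ (by fun_prop)),
    integral_const_mul, integral_const_mul, integral_const_mul, hV, h2,
    integral_re_conj_mul_sub, circlePseudoVar]
  simp [← hm]

lemma circleAbsMoment_three_le {η : ℝ} (hη : 0 < η) :
    circleAbsMoment 3 μ ≤ η * circleAbsMoment 2 μ + circleAbsMoment 4 μ / η := by
  unfold circleAbsMoment
  rw [← integral_const_mul, ← integral_div, ← integral_add]
  · refine integral_mono (integrable_circle_of_continuous μ (by fun_prop))
      (integrable_circle_of_continuous μ (by fun_prop)) fun ζ => ?_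
    simp only
    set x := ‖(ζ : ℂ) - circleMean μ‖
    have h : η * x ^ 2 + x ^ 4 / η - x ^ 3 = x ^ 2 / η * ((η - x / 2) ^ 2 + 3 / 4 * x ^ 2) := by
      field_simp; ring
    have : 0 ≤ x ^ 2 / η * ((η - x / 2) ^ 2 + 3 / 4 * x ^ 2) := by positivity
    linarith
  · exact integrable_circle_of_continuous μ (by fun_prop)
  · exact integrable_circle_of_continuous μ (by fun_prop)

lemma circleAbsMoment_four_le (hm : circleMean μ ≠ 0) :
    circleAbsMoment 4 μ ≤ 2 * (circleAbsMoment 2 μ + (circlePseudoVar μ / circleMean μ ^ 2).re)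
      + 4 * circleAbsMoment 2 μ * ‖circlePseudoVar μ / circleMean μ ^ 2‖ := by
  have ha := circleAbsMoment_nonneg 2 μ
  have h2 := circleAbsMoment_two μ
  rw [circleAbsMoment_four, ← h2]
  set m := circleMean μ
  set a := circleAbsMoment 2 μ
  set v := circlePseudoVar μ / m ^ 2 with hv
  have hV : starRingEnd ℂ m ^ 2 * circlePseudoVar μ = (((1 - a) ^ 2 : ℝ) : ℂ) * v := by
    have h1 : (1 - a) = ‖m‖ ^ 2 := by rw [h2]; ring
    have h3 : circlePseudoVar μ = m ^ 2 * v := by rw [hv]; field_simp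
    have h4 : starRingEnd ℂ m * m = ((‖m‖ ^ 2 : ℝ) : ℂ) := by
      rw [Complex.conj_mul']; push_cast; ring
    rw [h3, h1, ← mul_assoc, ← mul_pow, h4]; push_cast; ring
  have hm2 : ‖m‖ ^ 2 = 1 - a := by rw [h2]; ring
  have ha1 : a ≤ 1 := by nlinarith [sq_nonneg ‖m‖]
  rw [hV, re_ofReal_mul, hm2]
  have h5 := Complex.abs_re_le_norm v
  have h6 : -‖v‖ ≤ v.re := (abs_le.mp h5).1
  nlinarith [mul_nonneg (mul_nonneg ha (by linarith : 0 ≤ 2 - a)) (by linarith : 0 ≤ v.re + ‖v‖),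
    mul_nonneg (sq_nonneg a) (norm_nonneg v), sq_nonneg a]

end SingleMeasure

lemma le_norm_one_sub_mul {c : ℝ} {u z : ℂ} (hu : ‖u‖ ≤ 1) (hz : ‖z‖ ≤ 1 - c) :
    c ≤ ‖1 - u * z‖ := by
  have h1 := norm_sub_norm_le (1 : ℂ) (u * z)
  rw [norm_one, norm_mul] at h1
  have := mul_le_mul_of_nonneg_right hu (norm_nonneg z)
  linarith

section Transform

variable (μ : Measure Circle) [IsProbabilityMeasure μ] {c : ℝ} {z : ℂ}

lemma one_sub_coe_mul_ne_zero (hc : 0 < c) {u : ℂ} (hu : ‖u‖ ≤ 1) (hz : ‖z‖ ≤ 1 - c) :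
    1 - u * z ≠ 0 :=
  norm_pos_iff.mp (hc.trans_le (le_norm_one_sub_mul hu hz))

lemma continuous_circle_div (hc : 0 < c) (hz : ‖z‖ ≤ 1 - c) {f : Circle → ℂ}
    (hf : Continuous f) : Continuous fun ζ : Circle => f ζ / (1 - (ζ : ℂ) * z) :=
  hf.div (by fun_prop) fun ζ => one_sub_coe_mul_ne_zero hc (Circle.norm_coe ζ).le hz

lemma norm_circleRemainder_le (hc : 0 < c) (hz : ‖z‖ ≤ 1 - c) :
    ‖circleRemainder μ z‖ ≤ circleAbsMoment 2 μ / c := by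
  refine (norm_integral_le_integral_norm _).trans ?_
  unfold circleAbsMoment
  rw [← integral_div]
  refine integral_mono
    (integrable_circle_of_continuous μ (continuous_circle_div hc hz (by fun_prop))).norm
    (integrable_circle_of_continuous μ (by fun_prop)) fun ζ => ?_
  simp only [norm_div, norm_pow]
  gcongr
  exact le_norm_one_sub_mul (Circle.norm_coe ζ).le hz

lemma norm_circleRemainder_sub_le (hc : 0 < c) (hz : ‖z‖ ≤ 1 - c) :
    ‖circleRemainder μ z - circlePseudoVar μ / (1 - circleMean μ * z)‖
      ≤ circleAbsMoment 3 μ / c ^ 2 := by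
  have hD := le_norm_one_sub_mul (norm_circleMean_le_one μ) hz
  have hD0 := one_sub_coe_mul_ne_zero hc (norm_circleMean_le_one μ) hz
  have hz1 : ‖z‖ ≤ 1 := by linarith
  unfold circleRemainder circlePseudoVar circleAbsMoment
  set m := circleMean μ
  rw [← integral_div, ← integral_sub
    (integrable_circle_of_continuous μ (continuous_circle_div hc hz (by fun_prop)))
    (integrable_circle_of_continuous μ (by fun_prop)), ← integral_div]
  refine (norm_integral_le_integral_norm _).trans ?_
  refine integral_mono (integrable_circle_of_continuous μ
      ((continuous_circle_div hc hz (by fun_prop)).sub (by fun_prop))).norm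
    (integrable_circle_of_continuous μ (by fun_prop)) fun ζ => ?_
  have hE := le_norm_one_sub_mul (Circle.norm_coe ζ).le hz
  have hE0 := one_sub_coe_mul_ne_zero hc (Circle.norm_coe ζ).le hz
  have h : ((ζ : ℂ) - m) ^ 2 / (1 - (ζ : ℂ) * z) - ((ζ : ℂ) - m) ^ 2 / (1 - m * z)
      = ((ζ : ℂ) - m) ^ 3 * z / ((1 - (ζ : ℂ) * z) * (1 - m * z)) := by
    field_simp; ring
  simp only [h, norm_div, norm_mul, norm_pow]
  rw [sq c]
  gcongr
  exact mul_le_of_le_one_right (by positivity) hz1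

lemma psiT_eq (hc : 0 < c) (hz : ‖z‖ ≤ 1 - c) :
    psiT μ z = circleMean μ * z / (1 - circleMean μ * z)
      + z ^ 2 / (1 - circleMean μ * z) ^ 2 * circleRemainder μ z := by
  have hD0 := one_sub_coe_mul_ne_zero hc (norm_circleMean_le_one μ) hz
  have h0 := integral_sub_circleMean μ
  unfold psiT circleRemainder
  set m := circleMean μ
  have h : ∀ ζ : Circle, (ζ : ℂ) * z / (1 - (ζ : ℂ) * z) = m * z / (1 - m * z)
      + z / (1 - m * z) ^ 2 * ((ζ : ℂ) - m)
      + z ^ 2 / (1 - m * z) ^ 2 * (((ζ : ℂ) - m) ^ 2 / (1 - (ζ : ℂ) * z)) := by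
    intro ζ
    have hE0 := one_sub_coe_mul_ne_zero hc (Circle.norm_coe ζ).le hz
    have hD0' : 1 - z * m ≠ 0 := mul_comm m z ▸ hD0
    field_simp; ring
  simp_rw [h]
  rw [integral_add (integrable_circle_of_continuous μ (by fun_prop))
      ((integrable_circle_of_continuous μ
        (continuous_circle_div hc hz (by fun_prop))).const_mul _),
    integral_add (integrable_const _) (integrable_circle_of_continuous μ (by fun_prop)),
    integral_const_mul, integral_const_mul, h0]
  simp

/-- The relative deviation of the `B`-transform from the mean. -/
def relDevBT (μ : Measure Circle) (z : ℂ) : ℂ :=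
  z * circleRemainder μ z /
    (circleMean μ * (1 + z ^ 2 * (circleRemainder μ z / (1 - circleMean μ * z))))

lemma BT_eq (hc : 0 < c) (hz : ‖z‖ ≤ 1 - c) (hm : circleMean μ ≠ 0)
    (hq : 1 + z ^ 2 * (circleRemainder μ z / (1 - circleMean μ * z)) ≠ 0) :
    BT μ z = circleMean μ * (1 + relDevBT μ z) := by
  have hD0 := one_sub_coe_mul_ne_zero hc (norm_circleMean_le_one μ) hz
  unfold BT
  split_ifs with h
  · simp [h, relDevBT, circleMean]
  · rw [psiT_eq μ hc hz]
    unfold relDevBT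
    set m := circleMean μ
    set R := circleRemainder μ z
    have hD0' : 1 - z * m ≠ 0 := mul_comm m z ▸ hD0
    have hA : 1 + (m * z / (1 - m * z) + z ^ 2 / (1 - m * z) ^ 2 * R)
        = (1 - m * z + z ^ 2 * R) / (1 - m * z) ^ 2 := by
      field_simp; ring
    have hB : 1 + z ^ 2 * (R / (1 - m * z)) = (1 - m * z + z ^ 2 * R) / (1 - m * z) := by
      field_simp
    rw [hB] at hq ⊢
    have hq' : 1 - m * z + z ^ 2 * R ≠ 0 := fun h' => hq (by rw [h', zero_div])
    have hq'' : 1 - z * m + z ^ 2 * R ≠ 0 := mul_comm m z ▸ hq'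
    rw [hA]
    field_simp
    ring

lemma norm_circleRemainder_div_le (hc : 0 < c) (hz : ‖z‖ ≤ 1 - c) :
    ‖circleRemainder μ z / (1 - circleMean μ * z)‖ ≤ circleAbsMoment 2 μ / c ^ 2 := by
  have ha := circleAbsMoment_nonneg 2 μ
  rw [norm_div, sq c, ← div_div]
  exact div_le_div₀ (by positivity) (norm_circleRemainder_le μ hc hz) hc
    (le_norm_one_sub_mul (norm_circleMean_le_one μ) hz)

lemma half_le_norm_one_add (hc : 0 < c) (hz : ‖z‖ ≤ 1 - c)
    (ha : circleAbsMoment 2 μ ≤ c ^ 2 / 2) :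
    1 / 2 ≤ ‖1 + z ^ 2 * (circleRemainder μ z / (1 - circleMean μ * z))‖ := by
  have hq := norm_circleRemainder_div_le μ hc hz
  have hz1 : ‖z‖ ≤ 1 := by linarith
  have h1 : circleAbsMoment 2 μ / c ^ 2 ≤ 1 / 2 := by
    rw [div_le_iff₀ (by positivity)]; linarith
  set q := circleRemainder μ z / (1 - circleMean μ * z)
  have h2 : ‖z ^ 2 * q‖ ≤ 1 / 2 := by
    rw [norm_mul, norm_pow]
    exact (mul_le_of_le_one_left (norm_nonneg _) (pow_le_one₀ (norm_nonneg _) hz1)).trans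
      (hq.trans h1)
  have h3 := norm_sub_le_norm_add (1 : ℂ) (z ^ 2 * q)
  rw [norm_one] at h3
  linarith

lemma norm_relDevBT_le (hc : 0 < c) (hz : ‖z‖ ≤ 1 - c) (hm : 1 / 2 ≤ ‖circleMean μ‖)
    (ha : circleAbsMoment 2 μ ≤ c ^ 2 / 2) :
    ‖relDevBT μ z‖ ≤ 4 / c * circleAbsMoment 2 μ := by
  have h1 := half_le_norm_one_add μ hc hz ha
  have h2 := norm_circleRemainder_le μ hc hz
  have hz1 : ‖z‖ ≤ 1 := by linarith
  have ha0 := circleAbsMoment_nonneg 2 μ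
  unfold relDevBT
  rw [norm_div, norm_mul, norm_mul]
  calc _ ≤ (1 * (circleAbsMoment 2 μ / c)) / ((1 / 2) * (1 / 2)) := by gcongr
    _ = _ := by ring

lemma norm_relDevBT_sub_le (hc : 0 < c) (hz : ‖z‖ ≤ 1 - c) (hm : 1 / 2 ≤ ‖circleMean μ‖)
    (ha : circleAbsMoment 2 μ ≤ c ^ 2 / 2) :
    ‖relDevBT μ z - z / (1 - z) * (circlePseudoVar μ / circleMean μ ^ 2)‖
      ≤ 4 / c ^ 3 * circleAbsMoment 2 μ ^ 2 + 2 / c ^ 2 * circleAbsMoment 3 μ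
        + 4 / c ^ 2 * (‖circleMean μ - 1‖ * circleAbsMoment 2 μ) := by
  have hden := half_le_norm_one_add μ hc hz ha
  have hw := norm_relDevBT_le μ hc hz hm ha
  have hq := norm_circleRemainder_div_le μ hc hz
  have hG := norm_circleRemainder_sub_le μ hc hz
  have hV := norm_circlePseudoVar_le μ
  have hz1 : ‖z‖ ≤ 1 := by linarith
  have ha0 := circleAbsMoment_nonneg 2 μ
  have hG0 := circleAbsMoment_nonneg 3 μ
  have hD := le_norm_one_sub_mul (norm_circleMean_le_one μ) hz
  have hD0 := one_sub_coe_mul_ne_zero hc (norm_circleMean_le_one μ) hz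
  have hE := le_norm_one_sub_mul (u := 1) (by simp) hz
  rw [one_mul] at hE
  have hE0 : 1 - z ≠ 0 := norm_pos_iff.mp (hc.trans_le hE)
  have hm0 : circleMean μ ≠ 0 := norm_pos_iff.mp (by linarith)
  have hden0 : 1 + z ^ 2 * (circleRemainder μ z / (1 - circleMean μ * z)) ≠ 0 :=
    norm_pos_iff.mp (by linarith)
  have hwdef : relDevBT μ z * (1 + z ^ 2 * (circleRemainder μ z / (1 - circleMean μ * z)))
      = z * circleRemainder μ z / circleMean μ := by
    unfold relDevBT
    rw [← div_div, div_mul_cancel₀ _ hden0]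
  set w := relDevBT μ z
  set R := circleRemainder μ z
  set V := circlePseudoVar μ
  set m := circleMean μ
  set q := R / (1 - m * z)
  have hD0' : 1 - z * m ≠ 0 := mul_comm m z ▸ hD0
  have key : w - z / (1 - z) * (V / m ^ 2) = -(z ^ 2 * (q * w)) + z / m * (R - V / (1 - m * z))
      + z / m ^ 2 * (V * ((m - 1) / ((1 - m * z) * (1 - z)))) := by
    have h1 : w = -(z ^ 2 * (q * w)) + z * R / m := by rw [← hwdef]; ring
    have h2 : z / m * (V / (1 - m * z)) - z / (1 - z) * (V / m ^ 2)
        = z / m ^ 2 * (V * ((m - 1) / ((1 - m * z) * (1 - z)))) := by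
      field_simp; ring
    rw [← h2]
    nth_rewrite 1 [h1]
    ring
  rw [key]
  refine (norm_add_le _ _).trans (add_le_add ((norm_add_le _ _).trans (add_le_add ?_ ?_)) ?_)
  · rw [norm_neg, norm_mul, norm_mul, norm_pow]
    calc _ ≤ 1 ^ 2 * (circleAbsMoment 2 μ / c ^ 2 * (4 / c * circleAbsMoment 2 μ)) := by gcongr
      _ = _ := by field_simp
  · rw [norm_mul, norm_div]
    calc _ ≤ 1 / (1 / 2) * (circleAbsMoment 3 μ / c ^ 2) := by gcongr
      _ = _ := by ring
  · rw [norm_mul, norm_div, norm_mul, norm_div, norm_mul, norm_pow]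
    calc _ ≤ 1 / (1 / 2) ^ 2 * (circleAbsMoment 2 μ * (‖m - 1‖ / (c * c))) := by gcongr
      _ = _ := by ring

end Transform

section Products

lemma norm_prod_one_add_sub_exp_sum_le {ι : Type*} (s : Finset ι) (w : ι → ℂ)
    (hw : ∀ i ∈ s, ‖w i‖ ≤ 1) :
    ‖∏ i ∈ s, (1 + w i) - exp (∑ i ∈ s, w i)‖
      ≤ Real.exp (∑ i ∈ s, ‖w i‖) * ∑ i ∈ s, ‖w i‖ ^ 2 := by
  classical
  induction s using Finset.induction_on with
  | empty => simp
  | insert j s hj ih =>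
    have ih := ih fun i hi => hw i (Finset.mem_insert_of_mem hi)
    have hwj := hw j (Finset.mem_insert_self j s)
    rw [Finset.prod_insert hj, Finset.sum_insert hj, Finset.sum_insert hj, Finset.sum_insert hj,
      Complex.exp_add, Real.exp_add]
    set P := ∏ i ∈ s, (1 + w i)
    set S := ∑ i ∈ s, w i
    set T := ∑ i ∈ s, ‖w i‖
    set Q := ∑ i ∈ s, ‖w i‖ ^ 2
    have h1 : ‖exp S‖ ≤ Real.exp T := by
      rw [Complex.norm_exp]
      exact Real.exp_le_exp.mpr ((re_le_norm _).trans (norm_sum_le _ _))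
    have h2 : ‖1 + w j‖ ≤ Real.exp ‖w j‖ := by
      refine (norm_add_le _ _).trans ?_
      rw [norm_one, add_comm]
      exact Real.add_one_le_exp _
    have h3 : ‖1 + w j - exp (w j)‖ ≤ ‖w j‖ ^ 2 := by
      rw [norm_sub_rev, ← sub_sub]
      exact Complex.norm_exp_sub_one_sub_id_le hwj
    have h4 : 1 ≤ Real.exp ‖w j‖ := Real.one_le_exp (norm_nonneg _)
    have e : (1 + w j) * P - exp (w j) * exp S
        = (1 + w j) * (P - exp S) + (1 + w j - exp (w j)) * exp S := by ring
    rw [e]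
    refine (norm_add_le _ _).trans ?_
    rw [norm_mul, norm_mul]
    calc _ ≤ Real.exp ‖w j‖ * (Real.exp T * Q) + ‖w j‖ ^ 2 * (Real.exp ‖w j‖ * Real.exp T) := by
          gcongr
          exact h1.trans (le_mul_of_one_le_left (Real.exp_pos _).le h4)
      _ = _ := by ring

variable {α ι : Type*} {l : Filter α} {s : α → Finset ι}

lemma tendsto_prod_one_add_sub_exp_sum {w : α → ι → ℂ} {δ : α → ℝ} {C : ℝ}
    (hδ : Tendsto δ l (𝓝 0)) (hw : ∀ᶠ x in l, ∀ i ∈ s x, ‖w x i‖ ≤ δ x)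
    (hC : ∀ᶠ x in l, ∑ i ∈ s x, ‖w x i‖ ≤ C) :
    Tendsto (fun x => ∏ i ∈ s x, (1 + w x i) - exp (∑ i ∈ s x, w x i)) l (𝓝 0) := by
  have hlim : Tendsto (fun x => Real.exp C * (|δ x| * C)) l (𝓝 0) := by
    simpa using ((hδ.abs.mul_const C).const_mul (Real.exp C))
  refine squeeze_zero_norm' ?_ hlim
  filter_upwards [hw, hC, hδ.eventually_le_const one_pos] with x h1 h2 h3
  refine (norm_prod_one_add_sub_exp_sum_le _ _ fun i hi => (h1 i hi).trans h3).trans ?_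
  have h4 : ∑ i ∈ s x, ‖w x i‖ ^ 2 ≤ |δ x| * C := by
    calc ∑ i ∈ s x, ‖w x i‖ ^ 2 ≤ ∑ i ∈ s x, |δ x| * ‖w x i‖ := by
          refine Finset.sum_le_sum fun i hi => ?_
          rw [sq]
          exact mul_le_mul_of_nonneg_right ((h1 i hi).trans (le_abs_self _)) (norm_nonneg _)
      _ = |δ x| * ∑ i ∈ s x, ‖w x i‖ := by rw [Finset.mul_sum]
      _ ≤ _ := by gcongr
  gcongr

lemma one_sub_norm_sq_le {m : ℂ} {δ : ℝ} (hm : ‖m‖ ≤ 1) (hδ : ‖m - 1‖ ≤ δ) :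
    1 - ‖m‖ ^ 2 ≤ 2 * δ := by
  have h := norm_sub_norm_le (1 : ℂ) m
  rw [norm_one, norm_sub_rev] at h
  nlinarith [norm_nonneg m]

lemma tendsto_sum_one_sub_norm_sq {m : α → ι → ℂ} {δ : α → ℝ} {t : ℝ}
    (hδ : Tendsto δ l (𝓝 0)) (hmδ : ∀ x, ∀ i ∈ s x, ‖m x i - 1‖ ≤ δ x)
    (hm0 : ∀ x, ∀ i ∈ s x, m x i ≠ 0) (hm1 : ∀ x, ∀ i ∈ s x, ‖m x i‖ ≤ 1)
    (hprod : Tendsto (fun x => ∏ i ∈ s x, ‖m x i‖) l (𝓝 (Real.exp (-t / 2)))) :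
    Tendsto (fun x => ∑ i ∈ s x, (1 - ‖m x i‖ ^ 2)) l (𝓝 t) := by
  have hT : Tendsto (fun x => ∑ i ∈ s x, -Real.log (‖m x i‖ ^ 2)) l (𝓝 t) := by
    have h := ((hprod.log (Real.exp_ne_zero _)).const_mul (-2 : ℝ))
    rw [Real.log_exp, show -2 * (-t / 2) = t by ring] at h
    refine h.congr fun x => ?_
    rw [Real.log_prod fun i hi => norm_ne_zero_iff.mpr (hm0 x i hi), Finset.mul_sum]
    refine Finset.sum_congr rfl fun i _ => ?_
    rw [Real.log_pow]; push_cast; ring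
  have hL : Tendsto (fun x => (1 - 2 * δ x) * ∑ i ∈ s x, -Real.log (‖m x i‖ ^ 2)) l (𝓝 t) := by
    simpa using ((hδ.const_mul 2).const_sub 1).mul hT
  refine tendsto_of_tendsto_of_tendsto_of_le_of_le hL hT (fun x => ?_) (fun x => ?_)
  · simp only [Finset.mul_sum]
    refine Finset.sum_le_sum fun i hi => ?_
    have hx : 0 < ‖m x i‖ ^ 2 := by have := norm_pos_iff.mpr (hm0 x i hi); positivity
    have h1 := Real.one_sub_inv_le_log_of_pos hx
    have h2 := one_sub_norm_sq_le (hm1 x i hi) (hmδ x i hi)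
    have h3 : 0 ≤ -Real.log (‖m x i‖ ^ 2) := by
      have := Real.log_nonpos hx.le (pow_le_one₀ (norm_nonneg _) (hm1 x i hi))
      linarith
    calc _ ≤ ‖m x i‖ ^ 2 * -Real.log (‖m x i‖ ^ 2) := by gcongr; linarith
      _ ≤ ‖m x i‖ ^ 2 * ((‖m x i‖ ^ 2)⁻¹ - 1) := by gcongr; linarith
      _ = _ := by rw [mul_sub, mul_inv_cancel₀ hx.ne', mul_one]
  · refine Finset.sum_le_sum fun i hi => ?_
    have hx : 0 < ‖m x i‖ ^ 2 := by have := norm_pos_iff.mpr (hm0 x i hi); positivity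
    have h1 := Real.log_le_sub_one_of_pos hx
    linarith

/-- Since `∑ ‖v‖` is asymptotically at most `t` while the real part of `∑ v` tends to `-t`,
the imaginary part is forced to vanish in the limit. -/
lemma tendsto_sum_of_tendsto_prod_one_add {v : α → ι → ℂ} {a : α → ι → ℝ} {δ : α → ℝ} {t : ℝ}
    (hδ : Tendsto δ l (𝓝 0)) (ha : ∀ x, ∀ i ∈ s x, a x i ≤ 2 * δ x)
    (hv : ∀ x, ∀ i ∈ s x, (1 - 2 * δ x) * ‖v x i‖ ≤ a x i)
    (hsum : Tendsto (fun x => ∑ i ∈ s x, a x i) l (𝓝 t))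
    (hprod : Tendsto (fun x => ∏ i ∈ s x, (1 + v x i)) l (𝓝 (Real.exp (-t) : ℂ))) :
    Tendsto (fun x => ∑ i ∈ s x, v x i) l (𝓝 (-t : ℂ)) := by
  have hU : Tendsto (fun x => (∑ i ∈ s x, a x i) / (1 - 2 * δ x)) l (𝓝 t) := by
    have h := hsum.div ((hδ.const_mul 2).const_sub 1) (by norm_num)
    simpa [Pi.div_def] using h
  have hδ' : ∀ᶠ x in l, 1 / 2 < 1 - 2 * δ x := by
    filter_upwards [hδ.eventually_lt_const (show (0 : ℝ) < 1 / 4 by norm_num)] with x hx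
    linarith
  have hvU : ∀ᶠ x in l, ∑ i ∈ s x, ‖v x i‖ ≤ (∑ i ∈ s x, a x i) / (1 - 2 * δ x) := by
    filter_upwards [hδ'] with x hx
    rw [le_div_iff₀ (by linarith), mul_comm, Finset.mul_sum]
    exact Finset.sum_le_sum (hv x)
  have hexp : Tendsto (fun x => exp (∑ i ∈ s x, v x i)) l (𝓝 (Real.exp (-t) : ℂ)) := by
    have h := tendsto_prod_one_add_sub_exp_sum (l := l) (s := s) (w := v) (δ := fun x => 4 * δ x)
      (C := t + 1) (by simpa using hδ.const_mul 4) ?_ ?_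
    · simpa using hprod.sub h
    · filter_upwards [hδ'] with x hx i hi
      nlinarith [ha x i hi, hv x i hi, norm_nonneg (v x i)]
    · filter_upwards [hvU, hU.eventually_le_const (lt_add_one t)] with x h1 h2
      exact h1.trans h2
  have hre : Tendsto (fun x => (∑ i ∈ s x, v x i).re) l (𝓝 (-t)) := by
    have h := hexp.norm
    simp only [Complex.norm_exp, Complex.norm_real, Real.norm_eq_abs, Real.abs_exp] at h
    simpa using h.log (Real.exp_ne_zero _)
  have him : Tendsto (fun x => (∑ i ∈ s x, v x i).im) l (𝓝 0) := by
    have h0 : Tendsto (fun x => √(((∑ i ∈ s x, a x i) / (1 - 2 * δ x)) ^ 2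
        - (∑ i ∈ s x, v x i).re ^ 2)) l (𝓝 0) := by
      simpa using ((hU.pow 2).sub (hre.pow 2)).sqrt
    refine squeeze_zero_norm' ?_ h0
    filter_upwards [hvU] with x hx
    have h1 := (norm_sum_le (s x) (v x)).trans hx
    have h2 := pow_le_pow_left₀ (norm_nonneg _) h1 2
    rw [← Complex.normSq_eq_norm_sq, Complex.normSq_apply] at h2
    refine Real.abs_le_sqrt ?_
    linarith
  have h := ((continuous_ofReal.tendsto _).comp hre).add
    (((continuous_ofReal.tendsto _).comp him).mul_const I)
  simp only [Function.comp_def, re_add_im] at h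
  simpa using h

end Products

section Array

lemma norm_circleMean_sub_one_le (μ : Measure Circle) [IsProbabilityMeasure μ] {ε : ℝ}
    (hε : 0 ≤ ε) :
    ‖circleMean μ - 1‖ ≤ ε + 2 * μ.real {ζ : Circle | ε ≤ ‖(ζ : ℂ) - 1‖} := by
  have hS : MeasurableSet {ζ : Circle | ε ≤ ‖(ζ : ℂ) - 1‖} :=
    (isClosed_le continuous_const (by fun_prop)).measurableSet
  set S := {ζ : Circle | ε ≤ ‖(ζ : ℂ) - 1‖}
  have h1 : circleMean μ - 1 = ∫ ζ : Circle, ((ζ : ℂ) - 1) ∂μ := by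
    rw [integral_sub (integrable_circle_of_continuous μ (by fun_prop)) (integrable_const _)]
    simp [circleMean]
  rw [h1]
  refine (norm_integral_le_integral_norm _).trans ?_
  have hind : Integrable (S.indicator fun _ => (2 : ℝ)) μ := (integrable_const _).indicator hS
  calc _ ≤ ∫ ζ, (ε + S.indicator (fun _ => (2 : ℝ)) ζ) ∂μ := by
        refine integral_mono (integrable_circle_of_continuous μ (by fun_prop))
          ((integrable_const _).add hind) fun ζ => ?_
        by_cases hζ : ζ ∈ S
        · have h2 := norm_sub_le (ζ : ℂ) 1
          rw [Circle.norm_coe, norm_one] at h2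
          simp only [Set.indicator_of_mem hζ]
          linarith
        · simp only [Set.indicator_of_notMem hζ, add_zero]
          exact (not_le.mp hζ).le
    _ = _ := by
        rw [integral_add (integrable_const _) hind, integral_indicator_const _ hS]
        simp [mul_comm]

lemma IsInfinitesimalArrayT.exists_norm_circleMean_sub_one_le {kn : ℕ → ℕ}
    {μ : ℕ → ℕ → Measure Circle} (hprob : ∀ n i, IsProbabilityMeasure (μ n i))
    (hinf : IsInfinitesimalArrayT kn μ) :
    ∃ δ : ℕ → ℝ, Tendsto δ atTop (𝓝 0) ∧
      ∀ n, ∀ i ∈ Finset.range (kn n), ‖circleMean (μ n i) - 1‖ ≤ δ n := by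
  refine ⟨fun n => ((Finset.range (kn n)).sup fun i => ‖circleMean (μ n i) - 1‖₊ : NNReal),
    ?_, fun n i hi => ?_⟩
  · rw [Metric.tendsto_atTop]
    intro ε hε
    obtain ⟨N, hN⟩ := hinf (ε / 4) (by positivity) (ENNReal.ofReal (ε / 4)) (by simpa using hε)
    refine ⟨N, fun n hn => ?_⟩
    rw [Real.dist_0_eq_abs, abs_of_nonneg (NNReal.coe_nonneg _)]
    have h : ((Finset.range (kn n)).sup fun i => ‖circleMean (μ n i) - 1‖₊)
        ≤ (3 * (ε / 4)).toNNReal := by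
      refine Finset.sup_le fun i hi => ?_
      have h1 := norm_circleMean_sub_one_le (μ n i) (ε := ε / 4) (by positivity)
      have h2 : (μ n i).real {ζ : Circle | ε / 4 ≤ ‖(ζ : ℂ) - 1‖} ≤ ε / 4 :=
        ENNReal.toReal_le_of_le_ofReal (by positivity) (hN n hn i (Finset.mem_range.mp hi)).le
      refine NNReal.le_toNNReal_of_coe_le ?_
      rw [coe_nnnorm]
      linarith
    have h' := NNReal.coe_le_coe.mpr h
    rw [Real.coe_toNNReal _ (by positivity)] at h'
    linarith
  · exact NNReal.coe_le_coe.mpr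
      (Finset.le_sup (f := fun i => ‖circleMean (μ n i) - 1‖₊) hi)

lemma tendsto_zero_of_forall_le_mul_add_div {α : Type*} {l : Filter α} {g a f : α → ℝ} {t : ℝ}
    (hg : ∀ x, 0 ≤ g x) (ha : Tendsto a l (𝓝 t)) (hf : Tendsto f l (𝓝 0))
    (h : ∀ η : ℝ, 0 < η → ∀ x, g x ≤ η * a x + f x / η) : Tendsto g l (𝓝 0) := by
  rw [Metric.tendsto_nhds]
  intro ε hε
  have hη : 0 < ε / (2 * (|t| + 1)) := by positivity
  have hlim := (ha.const_mul (ε / (2 * (|t| + 1)))).add (hf.div_const (ε / (2 * (|t| + 1))))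
  have hlt : ε / (2 * (|t| + 1)) * t + 0 / (ε / (2 * (|t| + 1))) < ε := by
    rw [zero_div, add_zero]
    calc _ ≤ ε / (2 * (|t| + 1)) * (|t| + 1) := by
          gcongr
          linarith [le_abs_self t]
      _ = ε / 2 := by field_simp
      _ < ε := by linarith
  filter_upwards [hlim.eventually_lt_const hlt] with x hx
  rw [Real.dist_0_eq_abs, abs_of_nonneg (hg x)]
  exact (h _ hη x).trans_lt hx

variable (kn : ℕ → ℕ) (μ : ℕ → ℕ → Measure Circle)

lemma circlePseudoVar_div_eq (ν : Measure Circle) [IsProbabilityMeasure ν]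
    (hm : circleMean ν ≠ 0) :
    1 + circlePseudoVar ν / circleMean ν ^ 2
      = (∫ ζ : Circle, (ζ : ℂ) ^ 2 ∂ν) / circleMean ν ^ 2 := by
  rw [circlePseudoVar_eq]
  field_simp
  ring

lemma tendsto_sums_of_tendsto_moments (hprob : ∀ n i, IsProbabilityMeasure (μ n i))
    (hm0 : ∀ n, ∀ i ∈ Finset.range (kn n), circleMean (μ n i) ≠ 0)
    {δ : ℕ → ℝ} (hδ : Tendsto δ atTop (𝓝 0))
    (hmδ : ∀ n, ∀ i ∈ Finset.range (kn n), ‖circleMean (μ n i) - 1‖ ≤ δ n)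
    (lam : ℕ → Circle) (γ : Circle) (t : ℝ)
    (h1 : Tendsto (fun n => (lam n : ℂ) * ∏ i ∈ Finset.range (kn n), circleMean (μ n i))
      atTop (𝓝 (γ * exp (-(t : ℂ) / 2))))
    (h2 : Tendsto (fun n => (lam n : ℂ) ^ 2 *
        ∏ i ∈ Finset.range (kn n), ∫ ζ : Circle, (ζ : ℂ) ^ 2 ∂(μ n i))
      atTop (𝓝 (γ ^ 2 * exp (-(t : ℂ) * 2)))) :
    Tendsto (fun n => ∑ i ∈ Finset.range (kn n), circleAbsMoment 2 (μ n i)) atTop (𝓝 t) ∧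
    Tendsto (fun n => ∑ i ∈ Finset.range (kn n), circlePseudoVar (μ n i) / circleMean (μ n i) ^ 2)
      atTop (𝓝 (-t : ℂ)) ∧
    Tendsto (fun n => ∑ i ∈ Finset.range (kn n), circleAbsMoment 3 (μ n i)) atTop (𝓝 0) := by
  have ha : Tendsto (fun n => ∑ i ∈ Finset.range (kn n), circleAbsMoment 2 (μ n i))
      atTop (𝓝 t) := by
    simp only [circleAbsMoment_two]
    refine tendsto_sum_one_sub_norm_sq hδ hmδ hm0 (fun n i _ => norm_circleMean_le_one _) ?_
    have h := h1.norm
    simp only [norm_mul, Circle.norm_coe, one_mul, norm_prod, Complex.norm_exp] at h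
    simpa using h
  have ha2 : ∀ n, ∀ i ∈ Finset.range (kn n), circleAbsMoment 2 (μ n i) ≤ 2 * δ n := by
    intro n i hi
    rw [circleAbsMoment_two]
    exact one_sub_norm_sq_le (norm_circleMean_le_one _) (hmδ n i hi)
  have hva : ∀ n, ∀ i ∈ Finset.range (kn n),
      (1 - 2 * δ n) * ‖circlePseudoVar (μ n i) / circleMean (μ n i) ^ 2‖
        ≤ circleAbsMoment 2 (μ n i) := by
    intro n i hi
    have h3 := ha2 n i hi
    have hpos : 0 < ‖circleMean (μ n i)‖ ^ 2 := by
      have := norm_pos_iff.mpr (hm0 n i hi); positivity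
    calc _ ≤ ‖circleMean (μ n i)‖ ^ 2 * ‖circlePseudoVar (μ n i) / circleMean (μ n i) ^ 2‖ := by
          gcongr
          rw [circleAbsMoment_two] at h3
          linarith
      _ = ‖circlePseudoVar (μ n i)‖ := by
          rw [norm_div, norm_pow, mul_div_cancel₀ _ hpos.ne']
      _ ≤ _ := norm_circlePseudoVar_le _
  have hv : Tendsto (fun n => ∑ i ∈ Finset.range (kn n),
      circlePseudoVar (μ n i) / circleMean (μ n i) ^ 2) atTop (𝓝 (-t : ℂ)) := by
    refine tendsto_sum_of_tendsto_prod_one_add hδ ha2 hva ha ?_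
    have hγ : (γ : ℂ) ≠ 0 := Circle.coe_ne_zero γ
    have h := h2.div (h1.pow 2) (pow_ne_zero 2 (mul_ne_zero hγ (exp_ne_zero _)))
    have e : (γ : ℂ) ^ 2 * exp (-(t : ℂ) * 2) / (γ * exp (-(t : ℂ) / 2)) ^ 2
        = (Real.exp (-t) : ℂ) := by
      rw [mul_pow, mul_div_mul_left _ _ (pow_ne_zero 2 hγ), ← Complex.exp_nat_mul,
        ← Complex.exp_sub, ofReal_exp]
      congr 1
      push_cast; ring
    rw [e] at h
    refine h.congr fun n => ?_
    rw [Finset.prod_congr rfl fun i hi => circlePseudoVar_div_eq (μ n i) (hm0 n i hi),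
      Finset.prod_div_distrib, Finset.prod_pow, Pi.div_apply, mul_pow,
      mul_div_mul_left _ _ (pow_ne_zero 2 (Circle.coe_ne_zero (lam n)))]
  have hf : Tendsto (fun n => ∑ i ∈ Finset.range (kn n), circleAbsMoment 4 (μ n i))
      atTop (𝓝 0) := by
    have hre := (continuous_re.tendsto _).comp hv
    have hlim : Tendsto (fun n => 2 * (∑ i ∈ Finset.range (kn n), circleAbsMoment 2 (μ n i)
        + (∑ i ∈ Finset.range (kn n), circlePseudoVar (μ n i) / circleMean (μ n i) ^ 2).re)
        + 16 * δ n * ∑ i ∈ Finset.range (kn n), circleAbsMoment 2 (μ n i)) atTop (𝓝 0) := by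
      simpa using ((ha.add hre).const_mul 2).add ((hδ.const_mul 16).mul ha)
    refine squeeze_zero' (Eventually.of_forall fun n => Finset.sum_nonneg fun i _ =>
      circleAbsMoment_nonneg 4 _) ?_ hlim
    filter_upwards [hδ.eventually_le_const (show (0 : ℝ) < 1 / 4 by norm_num)] with n hn
    rw [re_sum, ← Finset.sum_add_distrib, Finset.mul_sum, Finset.mul_sum,
      ← Finset.sum_add_distrib]
    refine Finset.sum_le_sum fun i hi => (circleAbsMoment_four_le _ (hm0 n i hi)).trans ?_
    have h3 := hva n i hi
    have h4 := ha2 n i hi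
    have h5 := circleAbsMoment_nonneg 2 (μ n i)
    have h6 : ‖circlePseudoVar (μ n i) / circleMean (μ n i) ^ 2‖
        ≤ 2 * circleAbsMoment 2 (μ n i) := by
      nlinarith [norm_nonneg (circlePseudoVar (μ n i) / circleMean (μ n i) ^ 2)]
    have h7 := mul_le_mul h4 h6 (norm_nonneg _) (h5.trans h4)
    linarith
  refine ⟨ha, hv, tendsto_zero_of_forall_le_mul_add_div (fun n => Finset.sum_nonneg fun i _ =>
    circleAbsMoment_nonneg 3 _) ha hf fun η hη n => ?_⟩
  rw [Finset.mul_sum, Finset.sum_div, ← Finset.sum_add_distrib]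
  exact Finset.sum_le_sum fun i _ => circleAbsMoment_three_le _ hη

lemma tendstoUniformlyOn_prod_BT (hprob : ∀ n i, IsProbabilityMeasure (μ n i))
    (hinf : IsInfinitesimalArrayT kn μ)
    (hmom : ∀ n : ℕ, ∀ i < kn n, (∫ ζ : Circle, (ζ : ℂ) ∂(μ n i)) ≠ 0)
    (lam : ℕ → Circle) (γ : Circle) (t : ℝ)
    (hfourier : ∀ p : ℤ, Tendsto
      (fun n => ((lam n : ℂ)) ^ p *
        ∏ i ∈ Finset.range (kn n), ∫ ζ : Circle, (ζ : ℂ) ^ p ∂(μ n i))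
      atTop (𝓝 ((γ : ℂ) ^ p * Complex.exp (-(t : ℂ) * (p : ℂ) ^ 2 / 2))))
    {K : Set ℂ} (hK : K ⊆ ball (0 : ℂ) 1) (hKc : IsCompact K) :
    TendstoUniformlyOn
      (fun n z => ((lam n : ℂ)) * ∏ i ∈ Finset.range (kn n), BT (μ n i) z)
      (fun z => (γ : ℂ) * Complex.exp (-((t : ℂ) / 2) * ((1 + z) / (1 - z)))) atTop K := by
  have hm0 : ∀ n, ∀ i ∈ Finset.range (kn n), circleMean (μ n i) ≠ 0 :=
    fun n i hi => hmom n i (Finset.mem_range.mp hi)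
  obtain ⟨δ, hδ, hmδ⟩ := hinf.exists_norm_circleMean_sub_one_le hprob
  have h1 : Tendsto (fun n => (lam n : ℂ) * ∏ i ∈ Finset.range (kn n), circleMean (μ n i))
      atTop (𝓝 (γ * exp (-(t : ℂ) / 2))) := by
    simpa [circleMean] using hfourier 1
  have h2 : Tendsto (fun n => (lam n : ℂ) ^ 2 *
        ∏ i ∈ Finset.range (kn n), ∫ ζ : Circle, (ζ : ℂ) ^ 2 ∂(μ n i))
      atTop (𝓝 (γ ^ 2 * exp (-(t : ℂ) * 2))) := by
    have h := hfourier 2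
    rw [show -(t : ℂ) * ((2 : ℤ) : ℂ) ^ 2 / 2 = -(t : ℂ) * 2 by push_cast; ring] at h
    exact_mod_cast h
  obtain ⟨ha, hv, hg⟩ := tendsto_sums_of_tendsto_moments kn μ hprob hm0 hδ hmδ lam γ t h1 h2
  obtain ⟨c, hc, hKz⟩ : ∃ c : ℝ, 0 < c ∧ ∀ z ∈ K, ‖z‖ ≤ 1 - c := by
    obtain ⟨r, hr, hKr⟩ := exists_lt_subset_ball hKc.isClosed hK
    exact ⟨1 - r, by linarith, fun z hz => by
      have := hKr hz
      rw [mem_ball_zero_iff] at this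
      linarith⟩
  have hden : ∀ z ∈ K, c ≤ ‖1 - z‖ := fun z hz => by
    simpa using le_norm_one_sub_mul (u := 1) (by simp) (hKz z hz)
  have ha2 : ∀ n, ∀ i ∈ Finset.range (kn n), circleAbsMoment 2 (μ n i) ≤ 2 * δ n := by
    intro n i hi
    rw [circleAbsMoment_two]
    exact one_sub_norm_sq_le (norm_circleMean_le_one _) (hmδ n i hi)
  rw [tendstoUniformlyOn_iff_tendsto, uniformity_eq_comap_nhds_zero, tendsto_comap_iff]
  set L : Filter (ℕ × ℂ) := atTop ×ˢ 𝓟 K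
  have hfst : Tendsto Prod.fst L atTop := tendsto_fst
  have hLK : ∀ᶠ x in L, x.2 ∈ K := tendsto_snd.eventually (eventually_mem_principal K)
  have hsmall : ∀ᶠ x in L, ∀ i ∈ Finset.range (kn x.1), 1 / 2 ≤ ‖circleMean (μ x.1 i)‖ ∧
      circleAbsMoment 2 (μ x.1 i) ≤ c ^ 2 / 2 := by
    have hev : ∀ᶠ n in atTop, δ n < min (1 / 2) (c ^ 2 / 4) :=
      hδ.eventually_lt_const (by positivity)
    filter_upwards [hfst.eventually hev] with x hx i hi
    obtain ⟨hx1, hx2⟩ := lt_min_iff.mp hx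
    have h3 := hmδ x.1 i hi
    have h4 := norm_sub_norm_le (1 : ℂ) (circleMean (μ x.1 i))
    rw [norm_one, norm_sub_rev] at h4
    exact ⟨by linarith, by linarith [ha2 x.1 i hi]⟩
  have hdiff : Tendsto (fun x : ℕ × ℂ => ∑ i ∈ Finset.range (kn x.1), (relDevBT (μ x.1 i) x.2
      - x.2 / (1 - x.2) * (circlePseudoVar (μ x.1 i) / circleMean (μ x.1 i) ^ 2)))
      L (𝓝 0) := by
    have hlim : Tendsto (fun n => (4 / c ^ 3 * 2 + 4 / c ^ 2) *
        (δ n * ∑ i ∈ Finset.range (kn n), circleAbsMoment 2 (μ n i))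
        + 2 / c ^ 2 * ∑ i ∈ Finset.range (kn n), circleAbsMoment 3 (μ n i)) atTop (𝓝 0) := by
      simpa using ((hδ.mul ha).const_mul (4 / c ^ 3 * 2 + 4 / c ^ 2)).add
        (hg.const_mul (2 / c ^ 2))
    refine squeeze_zero_norm' ?_ (hlim.comp hfst)
    filter_upwards [hLK, hsmall] with x hxK hx
    refine (norm_sum_le _ _).trans ?_
    simp only [Function.comp_apply, Finset.mul_sum]
    rw [← Finset.sum_add_distrib]
    refine Finset.sum_le_sum fun i hi => ?_
    refine (norm_relDevBT_sub_le (μ x.1 i) hc (hKz _ hxK) (hx i hi).1 (hx i hi).2).trans ?_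
    have h5 := circleAbsMoment_nonneg 2 (μ x.1 i)
    have h6 : circleAbsMoment 2 (μ x.1 i) ^ 2 ≤ 2 * δ x.1 * circleAbsMoment 2 (μ x.1 i) := by
      rw [sq]; exact mul_le_mul_of_nonneg_right (ha2 x.1 i hi) h5
    calc _ ≤ 4 / c ^ 3 * (2 * δ x.1 * circleAbsMoment 2 (μ x.1 i))
          + 2 / c ^ 2 * circleAbsMoment 3 (μ x.1 i)
          + 4 / c ^ 2 * (δ x.1 * circleAbsMoment 2 (μ x.1 i)) := by
          gcongr
          exact hmδ x.1 i hi
      _ = _ := by ring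
  have hbdd : IsBoundedUnder (· ≤ ·) L (norm ∘ fun x : ℕ × ℂ => x.2 / (1 - x.2)) := by
    refine isBoundedUnder_of_eventually_le (a := 1 / c) ?_
    filter_upwards [hLK] with x hx
    rw [Function.comp_apply, norm_div]
    have := hKz _ hx
    have := hden _ hx
    gcongr
    linarith
  have hexpo : Tendsto (fun x : ℕ × ℂ => ∑ i ∈ Finset.range (kn x.1), relDevBT (μ x.1 i) x.2
      - -(t : ℂ) * (x.2 / (1 - x.2))) L (𝓝 0) := by
    have hvt : Tendsto (fun x : ℕ × ℂ => ∑ i ∈ Finset.range (kn x.1),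
        circlePseudoVar (μ x.1 i) / circleMean (μ x.1 i) ^ 2 - (-t : ℂ)) L (𝓝 0) := by
      simpa using (hv.comp hfst).sub_const (-t : ℂ)
    have h := hdiff.add (isBoundedUnder_le_mul_tendsto_zero hbdd hvt)
    rw [add_zero] at h
    refine h.congr fun x => ?_
    rw [Finset.sum_sub_distrib, ← Finset.mul_sum]
    ring
  have hprod : Tendsto (fun x : ℕ × ℂ =>
      ∏ i ∈ Finset.range (kn x.1), (1 + relDevBT (μ x.1 i) x.2)
        - exp (∑ i ∈ Finset.range (kn x.1), relDevBT (μ x.1 i) x.2)) L (𝓝 0) := by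
    refine tendsto_prod_one_add_sub_exp_sum (δ := fun x => 4 / c * (2 * δ x.1))
      (C := 4 / c * (t + 1)) ?_ ?_ ?_
    · simpa using ((hδ.comp hfst).const_mul 2).const_mul (4 / c)
    · filter_upwards [hLK, hsmall] with x hxK hx i hi
      refine (norm_relDevBT_le (μ x.1 i) hc (hKz _ hxK) (hx i hi).1 (hx i hi).2).trans ?_
      gcongr
      exact ha2 x.1 i hi
    · filter_upwards [hLK, hsmall, hfst.eventually (ha.eventually_le_const (lt_add_one t))]
        with x hxK hx hxt
      refine (Finset.sum_le_sum fun i hi =>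
        norm_relDevBT_le (μ x.1 i) hc (hKz _ hxK) (hx i hi).1 (hx i hi).2).trans ?_
      rw [← Finset.mul_sum]
      gcongr
  have hE : IsBoundedUnder (· ≤ ·) L
      (norm ∘ fun x : ℕ × ℂ => exp (-(t : ℂ) * (x.2 / (1 - x.2)))) := by
    obtain ⟨b, hb⟩ := hbdd
    refine isBoundedUnder_of_eventually_le (a := Real.exp (|t| * b)) ?_
    filter_upwards [eventually_map.mp hb] with x hx
    rw [Function.comp_apply, Complex.norm_exp]
    refine Real.exp_le_exp.mpr ((re_le_norm _).trans ?_)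
    rw [norm_mul, norm_neg, norm_real, Real.norm_eq_abs]
    exact mul_le_mul_of_nonneg_left hx (abs_nonneg t)
  have hM := h1.comp hfst
  have hexp1 := ((continuous_exp.tendsto _).comp hexpo).sub_const 1
  rw [exp_zero, sub_self] at hexp1
  have hM0 := hM.sub_const ((γ : ℂ) * exp (-(t : ℂ) / 2))
  rw [sub_self] at hM0
  have htotal := ((hM.mul hprod).add (hM.mul (isBoundedUnder_le_mul_tendsto_zero hE hexp1))).add
    (isBoundedUnder_le_mul_tendsto_zero hE hM0)
  rw [mul_zero, add_zero, add_zero] at htotal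
  refine htotal.congr' ?_
  filter_upwards [hLK, hsmall] with x hxK hx
  have hBT : ∏ i ∈ Finset.range (kn x.1), BT (μ x.1 i) x.2
      = (∏ i ∈ Finset.range (kn x.1), circleMean (μ x.1 i))
        * ∏ i ∈ Finset.range (kn x.1), (1 + relDevBT (μ x.1 i) x.2) := by
    rw [← Finset.prod_mul_distrib]
    refine Finset.prod_congr rfl fun i hi => BT_eq (μ x.1 i) hc (hKz _ hxK) (hm0 _ i hi) ?_
    exact norm_pos_iff.mp (lt_of_lt_of_le (by norm_num)
      (half_le_norm_one_add (μ x.1 i) hc (hKz _ hxK) (hx i hi).2))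
  have hz0 : 1 - x.2 ≠ 0 := norm_pos_iff.mp (hc.trans_le (hden _ hxK))
  have htarget : exp (-((t : ℂ) / 2) * ((1 + x.2) / (1 - x.2)))
      = exp (-(t : ℂ) / 2) * exp (-(t : ℂ) * (x.2 / (1 - x.2))) := by
    rw [← Complex.exp_add]
    congr 1
    field_simp
    ring
  simp only [Function.comp_apply, hBT, htarget, Complex.exp_sub]
  field_simp
  ring

end Array

/-- Corollary 4.2, classical ⇒ boolean: if the classical convolutions
δ_{λ_n} ⊛ μ_{n1} ⊛ ⋯ ⊛ μ_{nk_n} converge weakly to a normal distribution on 𝕋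
(Fourier coefficients γ^p e^{−tp²/2}), then the boolean convolutions converge weakly
to the ⨃-normal law with parameters γ and σ = (t/2)δ₁. -/
theorem stmt12
    (kn : ℕ → ℕ) (μ : ℕ → ℕ → Measure Circle)
    (hprob : ∀ n i, IsProbabilityMeasure (μ n i))
    (hinf : IsInfinitesimalArrayT kn μ)
    (hmom : ∀ n : ℕ, ∀ i < kn n, (∫ ζ : Circle, (ζ : ℂ) ∂(μ n i)) ≠ 0)
    (lam : ℕ → Circle)
    (γ : Circle) (t : ℝ) (ht : 0 < t)
    (hfourier : ∀ p : ℤ, Tendsto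
      (fun n => ((lam n : ℂ)) ^ p *
        ∏ i ∈ Finset.range (kn n), ∫ ζ : Circle, (ζ : ℂ) ^ p ∂(μ n i))
      atTop (𝓝 ((γ : ℂ) ^ p * Complex.exp (-(t : ℂ) * (p : ℂ) ^ 2 / 2)))) :
    ∀ K : Set ℂ, K ⊆ ball (0:ℂ) 1 → IsCompact K →
      TendstoUniformlyOn
        (fun n z => ((lam n : ℂ)) * ∏ i ∈ Finset.range (kn n), BT (μ n i) z)
        (fun z => (γ : ℂ) * Complex.exp (-((t : ℂ) / 2) * ((1 + z) / (1 - z))))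
        atTop K := by
  intro K hK hKc
  exact tendstoUniformlyOn_prod_BT kn μ hprob hinf hmom lam γ t hfourier hK hKc

end
end

section
/- Let m be Haar (normalized arclength) measure on 𝕋, let f(ζ) = 4π·Im ζ, and let f⁺, f⁻ be its positive and negative parts. Define finite positive Borel measures on 𝕋 by dσ₁(ζ) = (1−Re ζ)f⁺(ζ) dm(ζ) and dσ₂(ζ) = (1−Re ζ)f⁻(ζ) dm(ζ). Then σ₁ ≠ σ₂, yet for every p ∈ ℤ, exp(∫_𝕋 K_p(ζ) dσ₁(ζ)) = exp(∫_𝕋 K_p(ζ) dσ₂(ζ)). In particular, the quantities γ^p·exp(∫_𝕋 K_p dσ), p ∈ ℤ, do not determine the measure σ uniquely. -/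
open MeasureTheory Complex Filter Topology Metric

noncomputable section

/-- K_p(ζ) = (ζ^p − 1 − i·p·Im ζ)/(1 − Re ζ), with K_p(1) = −p². -/
def Kp (p : ℤ) (ζ : Circle) : ℂ :=
  if (ζ : ℂ) = 1 then -((p : ℂ))^2
  else ((ζ : ℂ) ^ p - 1 - Complex.I * (p : ℂ) * ((((ζ : ℂ)).im : ℝ) : ℂ))
      / (((1 - ((ζ : ℂ)).re : ℝ)) : ℂ)

/-- Haar (normalized arclength) measure on the circle: the pushforward of normalized
Lebesgue measure on (−π, π] under x ↦ e^{ix}. -/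
def haarT : Measure Circle :=
  Measure.map Circle.exp
    ((ENNReal.ofReal (2 * Real.pi))⁻¹ • volume.restrict (Set.Ioc (-Real.pi) Real.pi))

lemma integral_haarT {F : Circle → ℂ} (hF : Continuous F) :
    ∫ ζ, F ζ ∂haarT =
      (2 * Real.pi : ℂ)⁻¹ * ∫ θ in -Real.pi..Real.pi, F (Circle.exp θ) := by
  rw [haarT, integral_map Circle.exp.continuous.measurable.aemeasurable
    hF.measurable.aestronglyMeasurable, integral_smul_measure,
    intervalIntegral.integral_of_le (by linarith [Real.pi_pos]), ENNReal.toReal_inv,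
    ENNReal.toReal_ofReal (by positivity), Complex.real_smul]
  push_cast
  rfl

instance : IsFiniteMeasure haarT := by
  refine ⟨?_⟩
  rw [haarT, Measure.map_apply Circle.exp.continuous.measurable MeasurableSet.univ]
  simp [ENNReal.mul_lt_top_iff, Real.pi_pos]

lemma integrable_haarT {F : Circle → ℂ} (hF : Continuous F) : Integrable F haarT := by
  obtain ⟨C, hC⟩ := isCompact_univ.exists_bound_of_continuousOn hF.continuousOn
  exact Integrable.of_bound hF.measurable.aestronglyMeasurable C
    (ae_of_all _ fun ζ => hC ζ (Set.mem_univ ζ))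

lemma one_sub_re_mul_Kp (p : ℤ) (ζ : Circle) :
    ((1 - (ζ : ℂ).re : ℝ) : ℂ) * Kp p ζ =
      (ζ : ℂ) ^ p - 1 - I * (p : ℂ) * (((ζ : ℂ).im : ℝ) : ℂ) := by
  by_cases h : (ζ : ℂ) = 1
  · simp [Kp, h]
  · have hne : ((1 - (ζ : ℂ).re : ℝ) : ℂ) ≠ 0 := by
      intro h0
      have hre : (ζ : ℂ).re = 1 := by
        have := Complex.ofReal_eq_zero.mp h0
        linarith
      have hn := Circle.normSq_coe ζ
      rw [Complex.normSq_apply, hre] at hn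
      have him : (ζ : ℂ).im = 0 := by nlinarith
      exact h (Complex.ext (by simpa using hre) (by simpa using him))
    rw [Kp, if_neg h, mul_div_cancel₀ _ hne]

lemma continuous_Kp_numerator (p : ℤ) : Continuous fun ζ : Circle =>
    (ζ : ℂ) ^ p - 1 - I * (p : ℂ) * (((ζ : ℂ).im : ℝ) : ℂ) := by
  have h : Continuous fun ζ : Circle => (ζ : ℂ) ^ p :=
    Continuous.zpow₀ continuous_subtype_val p fun ζ => Or.inl (Circle.coe_ne_zero ζ)
  fun_prop

lemma integral_Kp_withDensity (p : ℤ) {g : Circle → ℝ} (hg : Continuous g)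
    (hg0 : ∀ ζ, 0 ≤ g ζ) :
    ∫ ζ, Kp p ζ ∂(haarT.withDensity fun ζ => ENNReal.ofReal ((1 - (ζ : ℂ).re) * g ζ)) =
      ∫ ζ : Circle, ((ζ : ℂ) ^ p - 1 - I * (p : ℂ) * (((ζ : ℂ).im : ℝ) : ℂ)) * (g ζ : ℂ)
        ∂haarT := by
  rw [integral_withDensity_eq_integral_toReal_smul]
  · refine integral_congr_ae (ae_of_all _ fun ζ => ?_)
    have hre : (ζ : ℂ).re ≤ 1 := (Complex.re_le_norm _).trans ζ.norm_coe.le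
    dsimp only
    rw [ENNReal.toReal_ofReal (mul_nonneg (by linarith) (hg0 ζ)), Complex.real_smul,
      ← one_sub_re_mul_Kp]
    push_cast
    ring
  · refine Measurable.ennreal_ofReal (Continuous.measurable ?_)
    fun_prop
  · exact ae_of_all _ fun ζ => ENNReal.ofReal_lt_top

lemma integral_exp_int_mul_I (n : ℤ) :
    ∫ θ in -Real.pi..Real.pi, Complex.exp (n * I * (θ : ℂ)) =
      if n = 0 then 2 * (Real.pi : ℂ) else 0 := by
  split_ifs with h
  · simp [h]
    ring
  · rw [integral_exp_mul_complex (mul_ne_zero (by exact_mod_cast h) I_ne_zero)]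
    have : Complex.exp (n * I * (Real.pi : ℂ)) = Complex.exp (n * I * ((-Real.pi : ℝ) : ℂ)) :=
      Complex.exp_eq_exp_iff_exists_int.mpr ⟨n, by push_cast; ring⟩
    rw [this, sub_self, zero_div]

/-- The integral of `K_p` against the signed measure `(1 - Re ζ) 4π Im ζ dm`. -/
lemma integral_Kp_numerator_mul_im (p : ℤ) :
    ∫ ζ : Circle, ((ζ : ℂ) ^ p - 1 - I * (p : ℂ) * (((ζ : ℂ).im : ℝ) : ℂ)) *
        ((4 * Real.pi * (ζ : ℂ).im : ℝ) : ℂ) ∂haarT =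
      2 * Real.pi * I *
        (((if p = 1 then 1 else 0) - (if p = -1 then 1 else 0) - p : ℤ) : ℂ) := by
  have hnum := continuous_Kp_numerator p
  rw [integral_haarT (by fun_prop)]
  have hE {F : ℝ → ℂ} (hF : Continuous F) : IntervalIntegrable F volume (-Real.pi) Real.pi :=
    hF.intervalIntegrable _ _
  have key (θ : ℝ) : ((Circle.exp θ : ℂ) ^ p - 1 -
        I * (p : ℂ) * (((Circle.exp θ : ℂ).im : ℝ) : ℂ)) *
        ((4 * Real.pi * (Circle.exp θ : ℂ).im : ℝ) : ℂ) =
      (-2 * Real.pi * I) * Complex.exp ((p + 1 : ℤ) * I * θ) +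
      (2 * Real.pi * I) * Complex.exp ((p - 1 : ℤ) * I * θ) +
      (2 * Real.pi * I) * Complex.exp ((1 : ℤ) * I * θ) +
      (-2 * Real.pi * I) * Complex.exp ((-1 : ℤ) * I * θ) +
      (Real.pi * I * p) * Complex.exp ((2 : ℤ) * I * θ) +
      (Real.pi * I * p) * Complex.exp ((-2 : ℤ) * I * θ) +
      (-2 * Real.pi * I * p) * Complex.exp ((0 : ℤ) * I * θ) := by
    have hexp (n : ℤ) : Complex.exp (n * I * θ) = Complex.exp (θ * I) ^ n := by
      rw [← Complex.exp_int_mul]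
      ring_nf
    have him : (((Circle.exp θ : ℂ).im : ℝ) : ℂ) =
        (Complex.exp (θ * I) ^ (-1 : ℤ) - Complex.exp (θ * I)) * I / 2 := by
      rw [Circle.coe_exp, Complex.exp_ofReal_mul_I_im, Complex.ofReal_sin, Complex.sin,
        zpow_neg_one, ← Complex.exp_neg, neg_mul]
    have hne := Complex.exp_ne_zero (θ * I)
    simp only [hexp, Complex.ofReal_mul]
    rw [him, Complex.ofReal_ofNat, Circle.coe_exp, zpow_add₀ hne, zpow_sub₀ hne]
    generalize Complex.exp (θ * I) ^ p = w
    generalize Complex.exp (θ * I) = z at *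
    simp only [zpow_neg, zpow_ofNat]
    field_simp
    linear_combination p * (8 * z ^ 2 - 4 * z ^ 4 - 4) * I_sq
  simp only [key]
  rw [intervalIntegral.integral_add (hE (by fun_prop)) (hE (by fun_prop)),
    intervalIntegral.integral_add (hE (by fun_prop)) (hE (by fun_prop)),
    intervalIntegral.integral_add (hE (by fun_prop)) (hE (by fun_prop)),
    intervalIntegral.integral_add (hE (by fun_prop)) (hE (by fun_prop)),
    intervalIntegral.integral_add (hE (by fun_prop)) (hE (by fun_prop)),
    intervalIntegral.integral_add (hE (by fun_prop)) (hE (by fun_prop))]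
  simp only [intervalIntegral.integral_const_mul, integral_exp_int_mul_I, add_eq_zero_iff_eq_neg,
    sub_eq_zero]
  have hpi : (Real.pi : ℂ) ≠ 0 := by exact_mod_cast Real.pi_ne_zero
  push_cast
  norm_num
  field_simp
  split_ifs <;> ring

lemma integral_Kp_sub (p : ℤ) :
    (∫ ζ : Circle, Kp p ζ
        ∂(haarT.withDensity (fun ζ =>
          ENNReal.ofReal ((1 - ((ζ : ℂ)).re) * max (4 * Real.pi * ((ζ : ℂ)).im) 0)))) -
      (∫ ζ : Circle, Kp p ζ
        ∂(haarT.withDensity (fun ζ =>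
          ENNReal.ofReal ((1 - ((ζ : ℂ)).re) * max (-(4 * Real.pi * ((ζ : ℂ)).im)) 0)))) =
      ∫ ζ : Circle, ((ζ : ℂ) ^ p - 1 - I * (p : ℂ) * (((ζ : ℂ).im : ℝ) : ℂ)) *
        ((4 * Real.pi * (ζ : ℂ).im : ℝ) : ℂ) ∂haarT := by
  have hnum := continuous_Kp_numerator p
  rw [integral_Kp_withDensity p (by fun_prop) fun ζ => le_max_right _ _,
    integral_Kp_withDensity p (by fun_prop) fun ζ => le_max_right _ _,
    ← integral_sub (integrable_haarT (by fun_prop)) (integrable_haarT (by fun_prop))]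
  refine integral_congr_ae (ae_of_all _ fun ζ => ?_)
  dsimp only
  rw [← mul_sub, ← Complex.ofReal_sub]
  congr 2
  rcases le_total 0 (4 * Real.pi * (ζ : ℂ).im) with h | h
  · rw [max_eq_left h, max_eq_right (by linarith), sub_zero]
  · rw [max_eq_right h, max_eq_left (by linarith), zero_sub, neg_neg]

/-- The remark after Corollary 4.2: with f(ζ) = 4π·Im ζ and
dσ₁ = (1−Re ζ)f⁺ dm, dσ₂ = (1−Re ζ)f⁻ dm, the measures σ₁ ≠ σ₂ satisfy
exp(∫ K_p dσ₁) = exp(∫ K_p dσ₂) for all p ∈ ℤ; so the quantities γ^p exp(∫K_p dσ)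
do not determine σ. -/
theorem stmt14 :
    (haarT.withDensity (fun ζ =>
        ENNReal.ofReal ((1 - ((ζ : ℂ)).re) * max (4 * Real.pi * ((ζ : ℂ)).im) 0))) ≠
      (haarT.withDensity (fun ζ =>
        ENNReal.ofReal ((1 - ((ζ : ℂ)).re) * max (-(4 * Real.pi * ((ζ : ℂ)).im)) 0))) ∧
    ∀ p : ℤ,
      Complex.exp (∫ ζ : Circle, Kp p ζ
          ∂(haarT.withDensity (fun ζ =>
            ENNReal.ofReal ((1 - ((ζ : ℂ)).re) * max (4 * Real.pi * ((ζ : ℂ)).im) 0)))) =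
      Complex.exp (∫ ζ : Circle, Kp p ζ
          ∂(haarT.withDensity (fun ζ =>
            ENNReal.ofReal ((1 - ((ζ : ℂ)).re) * max (-(4 * Real.pi * ((ζ : ℂ)).im)) 0)))) := by
  refine ⟨fun h => ?_, fun p => ?_⟩
  · have h2 := integral_Kp_sub 2
    rw [h, sub_self, integral_Kp_numerator_mul_im] at h2
    simp [Real.pi_ne_zero] at h2
  · refine Complex.exp_eq_exp_iff_exists_int.mpr
      ⟨(if p = 1 then 1 else 0) - (if p = -1 then 1 else 0) - p, ?_⟩
    rw [← sub_eq_iff_eq_add', integral_Kp_sub, integral_Kp_numerator_mul_im, mul_comm]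

end
end
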